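/- Let k ≥ 2 be a fixed integer. For every ε > 0 there is a constant C(ε) > 0 such that for all δ > 0 and all integers N ≥ 1, the number of quadruples of integers (n_1, n_2, n_3, n_4) with N < n_i ≤ 2N for i = 1, 2, 3, 4 and |n_1^{1/k} + n_2^{1/k} − n_3^{1/k} − n_4^{1/k}| < δ N^{1/k} is at most C(ε) N^ε (N^4 δ + N²). -/

import Mathlib

open Real

/-- The Parseval identity for a finite set of characters of a finite abelian group. -/
theorem sum_norm_sq_sum_addChar {G : Type*} [AddCommGroup G] [Fintype G]
    (Ψ : Finset (AddChar G ℂ)) :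
    ∑ g, ‖∑ ψ ∈ Ψ, ψ g‖ ^ 2 = (Fintype.card G : ℝ) * Ψ.card := by
  classical
  have key : ((∑ g, ‖∑ ψ ∈ Ψ, ψ g‖ ^ 2 : ℝ) : ℂ) = ((Fintype.card G : ℝ) * Ψ.card : ℝ) := by
    push_cast
    have h1 : ∀ g, ((‖∑ ψ ∈ Ψ, ψ g‖ : ℂ)) ^ 2 = ∑ ψ ∈ Ψ, ∑ φ ∈ Ψ, (ψ * φ⁻¹) g := by
      intro g
      rw [← Complex.mul_conj', map_sum, Finset.sum_mul_sum]
      refine Finset.sum_congr rfl fun ψ _ => Finset.sum_congr rfl fun φ _ => ?_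
      rw [AddChar.mul_apply, AddChar.inv_apply, AddChar.map_neg_eq_conj]
    simp_rw [h1]
    rw [Finset.sum_comm]
    have h2 : ∀ ψ ∈ Ψ, ∑ g, ∑ φ ∈ Ψ, (ψ * φ⁻¹) g = Fintype.card G := by
      intro ψ hψ
      rw [Finset.sum_comm, Finset.sum_eq_single ψ]
      · simp
      · intro φ _ hne
        rw [AddChar.sum_eq_zero_iff_ne_zero]
        intro h
        apply hne
        have : ψ * φ⁻¹ = 1 := h
        exact (mul_inv_eq_one.1 this).symm
      · exact fun h => absurd hψ h
    rw [Finset.sum_congr rfl h2]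
    simp [mul_comm]
  exact_mod_cast key

/-- The character `g ↦ e(⟨v, g⟩ / M)` of `(ℤ / M)⁴`. -/
noncomputable def latticeChar (M : ℕ) [NeZero M] (v : ℤ × ℤ × ℤ × ℤ) :
    AddChar (ZMod M × ZMod M × ZMod M × ZMod M) ℂ where
  toFun g := ZMod.stdAddChar
    ((v.1 : ZMod M) * g.1 + (v.2.1 : ZMod M) * g.2.1 + (v.2.2.1 : ZMod M) * g.2.2.1 +
      (v.2.2.2 : ZMod M) * g.2.2.2)
  map_zero_eq_one' := by simp
  map_add_eq_mul' g h := by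
    rw [← AddChar.map_add_eq_mul]
    congr 1
    simp only [Prod.fst_add, Prod.snd_add]
    ring

theorem latticeChar_intCast (M : ℕ) [NeZero M] (v g : ℤ × ℤ × ℤ × ℤ) :
    latticeChar M v ((g.1 : ZMod M), (g.2.1 : ZMod M), (g.2.2.1 : ZMod M), (g.2.2.2 : ZMod M)) =
      Complex.exp (2 * π * Complex.I *
        (v.1 * g.1 + v.2.1 * g.2.1 + v.2.2.1 * g.2.2.1 + v.2.2.2 * g.2.2.2 : ℤ) / M) := by
  rw [← ZMod.stdAddChar_coe]
  change ZMod.stdAddChar _ = _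
  push_cast
  rfl

theorem latticeChar_injOn (M : ℕ) [NeZero M] (V : Finset (ℤ × ℤ × ℤ × ℤ))
    (hV : ∀ v ∈ V, 2 * |v.1| < M ∧ 2 * |v.2.1| < M ∧ 2 * |v.2.2.1| < M ∧ 2 * |v.2.2.2| < M) :
    Set.InjOn (latticeChar M) V := by
  intro v hv w hw h
  have cast_inj : ∀ a b : ℤ, 2 * |a| < M → 2 * |b| < M → (a : ZMod M) = b → a = b := by
    intro a b ha hb hab
    have hd := (ZMod.intCast_eq_intCast_iff_dvd_sub a b M).1 hab
    have : |b - a| < M := by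
      rw [abs_lt]
      rcases abs_cases a with h | h <;> rcases abs_cases b with h' | h' <;> constructor <;> omega
    have := Int.eq_zero_of_abs_lt_dvd hd this
    omega
  have hh : ∀ g, latticeChar M v g = latticeChar M w g := fun g => by rw [h]
  obtain ⟨v1, v2, v3, v4⟩ := v
  obtain ⟨w1, w2, w3, w4⟩ := w
  obtain ⟨a1, a2, a3, a4⟩ := hV _ hv
  obtain ⟨b1, b2, b3, b4⟩ := hV _ hw
  have e1 := ZMod.injective_stdAddChar (hh (1, 0, 0, 0))
  have e2 := ZMod.injective_stdAddChar (hh (0, 1, 0, 0))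
  have e3 := ZMod.injective_stdAddChar (hh (0, 0, 1, 0))
  have e4 := ZMod.injective_stdAddChar (hh (0, 0, 0, 1))
  simp only [mul_one, mul_zero, add_zero, zero_add] at e1 e2 e3 e4
  exact Prod.ext (cast_inj _ _ a1 b1 e1) (Prod.ext (cast_inj _ _ a2 b2 e2)
    (Prod.ext (cast_inj _ _ a3 b3 e3) (cast_inj _ _ a4 b4 e4)))

theorem half_le_re_exp {t : ℝ} (ht : |t| ≤ 1 / 6) :
    1 / 2 ≤ (Complex.exp (2 * π * Complex.I * t)).re := by
  have : (2 * π * Complex.I * t : ℂ) = ((2 * π * t : ℝ) : ℂ) * Complex.I := by push_cast; ring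
  rw [this, Complex.exp_ofReal_mul_I_re, ← Real.cos_pi_div_three, ← Real.cos_abs (2 * π * t)]
  apply Real.cos_le_cos_of_nonneg_of_le_pi (abs_nonneg _) (by linarith [Real.pi_pos])
  rw [abs_mul, abs_of_pos (by positivity : (0 : ℝ) < 2 * π)]
  nlinarith [Real.pi_pos]

theorem ceil_neg_add_mem (t : ℝ) (i : ℕ) :
    (i : ℝ) ≤ ((i : ℤ) + ⌈-t⌉ : ℤ) + t ∧ ((i : ℤ) + ⌈-t⌉ : ℤ) + t < i + 1 := by
  have h1 := Int.le_ceil (-t)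
  have h2 := Int.ceil_lt_add_one (-t)
  push_cast
  constructor <;> linarith

/-- A point of the lattice `ℤ⁴` whose coordinates in a sheared (unimodular) real frame
have integer parts prescribed by `i`. -/
noncomputable def shearedPoint (a1 a2 a4 r1 r2 : ℝ) (i : ℕ × ℕ × ℕ × ℕ) : ℤ × ℤ × ℤ × ℤ :=
  let g1 : ℤ := (i.2.1 : ℤ) + ⌈-(a1 * (i.1 : ℝ))⌉
  let g2 : ℤ := (i.2.2.1 : ℤ) + ⌈-(a2 * (i.1 : ℝ))⌉
  (g1, g2, (i.1 : ℤ), (i.2.2.2 : ℤ) + ⌈-(a4 * (i.1 : ℝ) + r1 * (g1 + a1 * (i.1 : ℝ)) +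
    r2 * (g2 + a2 * (i.1 : ℝ)))⌉)

theorem shearedPoint_injective (a1 a2 a4 r1 r2 : ℝ) :
    Function.Injective (shearedPoint a1 a2 a4 r1 r2) := by
  rintro ⟨i3, i1, i2, i4⟩ ⟨j3, j1, j2, j4⟩ h
  simp only [shearedPoint, Prod.mk.injEq] at h
  obtain ⟨h1, h2, h3, h4⟩ := h
  have h3' : i3 = j3 := by exact_mod_cast h3
  subst h3'
  have h1' : i1 = j1 := by omega
  have h2' : i2 = j2 := by omega
  subst h1' h2'
  have h4' : i4 = j4 := by omega
  rw [h4']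

theorem shearedPoint_mem (a1 a2 a4 r1 r2 Y0 Y1 Y3 : ℝ) (i : ℕ × ℕ × ℕ × ℕ)
    (hi : i ∈ Finset.range ⌊Y3⌋₊ ×ˢ Finset.range ⌊Y1⌋₊ ×ˢ Finset.range ⌊Y1⌋₊ ×ˢ
      Finset.range ⌊Y0⌋₊) (h0 : 0 ≤ Y0) (h1 : 0 ≤ Y1) (h3 : 0 ≤ Y3)
    (g : ℤ × ℤ × ℤ × ℤ) (hg : g = shearedPoint a1 a2 a4 r1 r2 i) :
    ((g.2.2.1 : ℝ) ∈ Set.Icc 0 Y3) ∧ ((g.1 + a1 * g.2.2.1 : ℝ) ∈ Set.Icc 0 Y1) ∧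
    ((g.2.1 + a2 * g.2.2.1 : ℝ) ∈ Set.Icc 0 Y1) ∧
    ((g.2.2.2 + a4 * g.2.2.1 + r1 * (g.1 + a1 * g.2.2.1) + r2 * (g.2.1 + a2 * g.2.2.1) : ℝ)
      ∈ Set.Icc 0 Y0) := by
  obtain ⟨i3, i1, i2, i4⟩ := i
  have lt_floor : ∀ (j : ℕ) (Y : ℝ), 0 ≤ Y → j < ⌊Y⌋₊ → (j : ℝ) + 1 ≤ Y := by
    intro j Y hY hj
    have : ((j + 1 : ℕ) : ℝ) ≤ ⌊Y⌋₊ := by exact_mod_cast hj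
    push_cast at this
    exact this.trans (Nat.floor_le hY)
  simp only [Finset.mem_product, Finset.mem_range] at hi
  obtain ⟨b3, b1, b2, b4⟩ := hi
  have c3 := lt_floor _ _ h3 b3
  have c1 := lt_floor _ _ h1 b1
  have c2 := lt_floor _ _ h1 b2
  have c4 := lt_floor _ _ h0 b4
  subst hg
  have d1 := ceil_neg_add_mem (a1 * (i3 : ℝ)) i1
  have d2 := ceil_neg_add_mem (a2 * (i3 : ℝ)) i2
  simp only [shearedPoint, Set.mem_Icc]
  set g1 : ℤ := (i1 : ℤ) + ⌈-(a1 * (i3 : ℝ))⌉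
  set g2 : ℤ := (i2 : ℤ) + ⌈-(a2 * (i3 : ℝ))⌉
  have d4 := ceil_neg_add_mem (a4 * (i3 : ℝ) + r1 * (g1 + a1 * (i3 : ℝ)) +
    r2 * (g2 + a2 * (i3 : ℝ))) i4
  have p1 : (0 : ℝ) ≤ i1 := by positivity
  have p2 : (0 : ℝ) ≤ i2 := by positivity
  have p3 : (0 : ℝ) ≤ i3 := by positivity
  have p4 : (0 : ℝ) ≤ i4 := by positivity
  simp only [Int.cast_natCast]
  refine ⟨⟨p3, by linarith⟩, ⟨by linarith [d1.1], by linarith [d1.2]⟩,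
    ⟨by linarith [d2.1], by linarith [d2.2]⟩, ⟨by linarith [d4.1], by linarith [d4.2]⟩⟩

theorem half_card_le_norm_sum_latticeChar (M : ℕ) [NeZero M] (a1 a2 a4 r1 r2 X0 X1 X3 : ℝ)
    (h0 : 0 < X0) (h1 : 0 < X1) (h3 : 0 < X3) (V : Finset (ℤ × ℤ × ℤ × ℤ))
    (hV : ∀ n ∈ V, |(n.2.2.2 : ℝ)| ≤ X0 ∧ |(n.1 : ℝ) - r1 * n.2.2.2| ≤ X1 ∧
      |(n.2.1 : ℝ) - r2 * n.2.2.2| ≤ X1 ∧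
      |(n.2.2.1 : ℝ) - a1 * n.1 - a2 * n.2.1 - a4 * n.2.2.2| ≤ X3)
    (g : ℤ × ℤ × ℤ × ℤ)
    (hg : ((g.2.2.1 : ℝ) ∈ Set.Icc 0 (1 / 24 * M / X3)) ∧
      ((g.1 + a1 * g.2.2.1 : ℝ) ∈ Set.Icc 0 (1 / 24 * M / X1)) ∧
      ((g.2.1 + a2 * g.2.2.1 : ℝ) ∈ Set.Icc 0 (1 / 24 * M / X1)) ∧
      ((g.2.2.2 + a4 * g.2.2.1 + r1 * (g.1 + a1 * g.2.2.1) + r2 * (g.2.1 + a2 * g.2.2.1) : ℝ)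
        ∈ Set.Icc 0 (1 / 24 * M / X0))) :
    (V.card : ℝ) / 2 ≤ ‖∑ v ∈ V, latticeChar M v
      ((g.1 : ZMod M), (g.2.1 : ZMod M), (g.2.2.1 : ZMod M), (g.2.2.2 : ZMod M))‖ := by
  have hM : (0 : ℝ) < M := by exact_mod_cast Nat.pos_of_ne_zero (NeZero.ne M)
  refine le_trans ?_ (Complex.re_le_norm _)
  rw [Complex.re_sum]
  have hc : (V.card : ℝ) / 2 = ∑ _v ∈ V, (1 / 2 : ℝ) := by simp [div_eq_mul_inv]
  rw [hc]
  refine Finset.sum_le_sum fun v hv => ?_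
  rw [latticeChar_intCast]
  set s : ℤ := v.1 * g.1 + v.2.1 * g.2.1 + v.2.2.1 * g.2.2.1 + v.2.2.2 * g.2.2.2 with hs
  have he : (2 * π * Complex.I * (s : ℂ) / M : ℂ) =
      2 * π * Complex.I * (((s : ℝ) / M : ℝ) : ℂ) := by
    push_cast; ring
  rw [he]
  apply half_le_re_exp
  obtain ⟨v0, v1, v2, v3⟩ := hV v hv
  obtain ⟨g3, g1, g2, g0⟩ := hg
  have bnd : ∀ x y X : ℝ, 0 < X → |x| ≤ X → y ∈ Set.Icc 0 (1 / 24 * M / X) →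
      |x * y| ≤ 1 / 24 * M := by
    intro x y X hX hx hy
    rw [abs_mul, abs_of_nonneg hy.1]
    calc |x| * y ≤ X * (1 / 24 * M / X) := by
          gcongr
          · exact hy.1
          · exact hy.2
      _ = 1 / 24 * M := by field_simp
  have q0 := bnd _ _ _ h0 v0 g0
  have q1 := bnd _ _ _ h1 v1 g1
  have q2 := bnd _ _ _ h1 v2 g2
  have q3 := bnd _ _ _ h3 v3 g3
  have hsum : (s : ℝ) = ((v.2.2.1 : ℝ) - a1 * v.1 - a2 * v.2.1 - a4 * v.2.2.2) * g.2.2.1 +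
      ((v.1 : ℝ) - r1 * v.2.2.2) * (g.1 + a1 * g.2.2.1) +
      ((v.2.1 : ℝ) - r2 * v.2.2.2) * (g.2.1 + a2 * g.2.2.1) +
      v.2.2.2 * (g.2.2.2 + a4 * g.2.2.1 + r1 * (g.1 + a1 * g.2.2.1) +
        r2 * (g.2.1 + a2 * g.2.2.1)) := by
    rw [hs]; push_cast; ring
  rw [abs_div, abs_of_pos hM, div_le_iff₀ hM, hsum]
  rw [abs_le] at *
  constructor <;> linarith [q0.1, q0.2, q1.1, q1.2, q2.1, q2.2, q3.1, q3.2]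

set_option maxHeartbeats 1000000 in
/-- Transference: the number of lattice points in a symmetric box is at most a constant times
its volume times the number of lattice points in the polar box. -/
theorem card_le_mul_card_dual (a1 a2 a4 r1 r2 X0 X1 X3 : ℝ)
    (h0 : 0 < X0) (h1 : 0 < X1) (h3 : 0 < X3) (V W : Finset (ℤ × ℤ × ℤ × ℤ))
    (hV : ∀ n ∈ V, |(n.2.2.2 : ℝ)| ≤ X0 ∧ |(n.1 : ℝ) - r1 * n.2.2.2| ≤ X1 ∧
      |(n.2.1 : ℝ) - r2 * n.2.2.2| ≤ X1 ∧
      |(n.2.2.1 : ℝ) - a1 * n.1 - a2 * n.2.1 - a4 * n.2.2.2| ≤ X3)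
    (hW : ∀ w : ℤ × ℤ × ℤ × ℤ, |(w.2.2.1 : ℝ)| ≤ 1 / 24 / X3 →
      |(w.1 : ℝ) + a1 * w.2.2.1| ≤ 1 / 24 / X1 → |(w.2.1 : ℝ) + a2 * w.2.2.1| ≤ 1 / 24 / X1 →
      |(w.2.2.2 : ℝ) + a4 * w.2.2.1 + r1 * (w.1 + a1 * w.2.2.1) + r2 * (w.2.1 + a2 * w.2.2.1)|
        ≤ 1 / 24 / X0 → w ∈ W) :
    (V.card : ℝ) ≤ 4 * 48 ^ 4 * (X0 * X1 ^ 2 * X3) * W.card := by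
  classical
  obtain ⟨M, hM0, hMV, hM0', hM1', hM3'⟩ : ∃ M : ℕ, 0 < M ∧ (∀ v ∈ V, 2 * |v.1| < M ∧
      2 * |v.2.1| < M ∧ 2 * |v.2.2.1| < M ∧ 2 * |v.2.2.2| < M) ∧
      1 ≤ 1 / 24 * M / X0 ∧ 1 ≤ 1 / 24 * M / X1 ∧ 1 ≤ 1 / 24 * M / X3 := by
    have hev : ∀ X : ℝ, 0 < X → ∀ᶠ M : ℕ in Filter.atTop, 1 ≤ 1 / 24 * (M : ℝ) / X := by
      intro X hX
      filter_upwards [Filter.eventually_ge_atTop ⌈24 * X⌉₊] with M hM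
      have : 24 * X ≤ M := Nat.ceil_le.1 hM
      rw [le_div_iff₀ hX]; linarith
    have hev2 : ∀ z : ℤ, ∀ᶠ M : ℕ in Filter.atTop, 2 * |z| < (M : ℤ) := by
      intro z
      filter_upwards [Filter.eventually_gt_atTop (2 * |z|).toNat] with M hM
      omega
    have hev3 : ∀ᶠ M : ℕ in Filter.atTop, ∀ v ∈ V, 2 * |v.1| < (M : ℤ) ∧
        2 * |v.2.1| < (M : ℤ) ∧ 2 * |v.2.2.1| < (M : ℤ) ∧ 2 * |v.2.2.2| < (M : ℤ) := by
      rw [Filter.eventually_all_finset]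
      intro v _
      exact (hev2 _).and ((hev2 _).and ((hev2 _).and (hev2 _)))
    exact ((Filter.eventually_gt_atTop 0).and (hev3.and ((hev _ h0).and
      ((hev _ h1).and (hev _ h3))))).exists
  have : NeZero M := ⟨hM0.ne'⟩
  have hMr : (0 : ℝ) < M := by exact_mod_cast hM0
  set Y0 := 1 / 24 * (M : ℝ) / X0 with hY0
  set Y1 := 1 / 24 * (M : ℝ) / X1 with hY1
  set Y3 := 1 / 24 * (M : ℝ) / X3 with hY3
  set I := Finset.range ⌊Y3⌋₊ ×ˢ Finset.range ⌊Y1⌋₊ ×ˢ Finset.range ⌊Y1⌋₊ ×ˢ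
    Finset.range ⌊Y0⌋₊ with hI
  have hfl : ∀ Y : ℝ, 1 ≤ Y → Y / 2 ≤ ⌊Y⌋₊ := by
    intro Y hY
    have a := Nat.lt_floor_add_one Y
    have b : (1 : ℝ) ≤ ⌊Y⌋₊ := by exact_mod_cast Nat.le_floor (by simpa using hY)
    linarith
  have hIcard : (M : ℝ) ^ 4 ≤ 48 ^ 4 * (X0 * X1 ^ 2 * X3) * I.card := by
    have e : (I.card : ℝ) = ⌊Y3⌋₊ * (⌊Y1⌋₊ * (⌊Y1⌋₊ * ⌊Y0⌋₊)) := by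
      simp [hI, Finset.card_product]
    have l : Y3 / 2 * (Y1 / 2 * (Y1 / 2 * (Y0 / 2))) ≤ I.card := by
      rw [e]
      have := hfl _ hM0'
      have := hfl _ hM1'
      have := hfl _ hM3'
      gcongr
    calc (M : ℝ) ^ 4 = 48 ^ 4 * (X0 * X1 ^ 2 * X3) * (Y3 / 2 * (Y1 / 2 * (Y1 / 2 * (Y0 / 2)))) := by
          rw [hY0, hY1, hY3]; field_simp; norm_num
      _ ≤ _ := by gcongr
  set red : ℤ × ℤ × ℤ × ℤ → ZMod M × ZMod M × ZMod M × ZMod M := fun g =>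
    ((g.1 : ZMod M), (g.2.1 : ZMod M), (g.2.2.1 : ZMod M), (g.2.2.2 : ZMod M)) with hred
  set G : ℕ × ℕ × ℕ × ℕ → ℤ × ℤ × ℤ × ℤ := shearedPoint a1 a2 a4 r1 r2 with hG
  have hmem := fun i hi => shearedPoint_mem a1 a2 a4 r1 r2 Y0 Y1 Y3 i hi
    (by linarith) (by linarith) (by linarith) (G i) rfl
  set E : ZMod M × ZMod M × ZMod M × ZMod M → ℝ := fun x => ‖∑ v ∈ V, latticeChar M v x‖ ^ 2
    with hE
  have hlow : ∀ i ∈ I, ((V.card : ℝ) / 2) ^ 2 ≤ E (red (G i)) := by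
    intro i hi
    have := half_card_le_norm_sum_latticeChar M a1 a2 a4 r1 r2 X0 X1 X3 h0 h1 h3 V hV (G i)
      (hmem i hi)
    simp only [hE]
    gcongr
  have hfib : ∀ x, ((I.filter fun i => red (G i) = x).card : ℝ) ≤ W.card := by
    intro x
    rcases (I.filter fun i => red (G i) = x).eq_empty_or_nonempty with he | ⟨i0, hi0⟩
    · rw [he]; simp
    rw [Finset.mem_filter] at hi0
    norm_cast
    have hdvd : ∀ i ∈ I.filter (fun i => red (G i) = x), ∃ w : ℤ × ℤ × ℤ × ℤ,
        (G i).1 = (G i0).1 + M * w.1 ∧ (G i).2.1 = (G i0).2.1 + M * w.2.1 ∧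
        (G i).2.2.1 = (G i0).2.2.1 + M * w.2.2.1 ∧
        (G i).2.2.2 = (G i0).2.2.2 + M * w.2.2.2 := by
      intro i hi
      rw [Finset.mem_filter] at hi
      have h := hi.2.trans hi0.2.symm
      simp only [hred, Prod.mk.injEq] at h
      have aux : ∀ a b : ℤ, (a : ZMod M) = b → ∃ c : ℤ, a = b + M * c := by
        intro a b hab
        obtain ⟨c, hc⟩ := (ZMod.intCast_eq_intCast_iff_dvd_sub b a M).1 hab.symm
        exact ⟨c, by omega⟩
      obtain ⟨c1, e1⟩ := aux _ _ h.1
      obtain ⟨c2, e2⟩ := aux _ _ h.2.1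
      obtain ⟨c3, e3⟩ := aux _ _ h.2.2.1
      obtain ⟨c4, e4⟩ := aux _ _ h.2.2.2
      exact ⟨(c1, c2, c3, c4), e1, e2, e3, e4⟩
    choose! w hw using hdvd
    apply Finset.card_le_card_of_injOn w
    · intro i hi
      obtain ⟨e1, e2, e3, e4⟩ := hw i hi
      obtain ⟨m3, m1, m2, m4⟩ := hmem i (Finset.mem_filter.1 hi).1
      obtain ⟨m3', m1', m2', m4'⟩ := hmem i0 hi0.1
      simp only [e1, e2, e3, e4, Int.cast_add, Int.cast_mul, Int.cast_natCast] at m1 m2 m3 m4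
      have diff : ∀ u z X : ℝ, u ∈ Set.Icc 0 (1 / 24 * (M : ℝ) / X) →
          u + M * z ∈ Set.Icc 0 (1 / 24 * (M : ℝ) / X) → |z| ≤ 1 / 24 / X := by
        intro u z X hu hz
        have hr : 1 / 24 * (M : ℝ) / X = M * (1 / 24 / X) := by ring
        rw [hr] at hu hz
        have k1 : M * z ≤ M * (1 / 24 / X) := by linarith [hz.2, hu.1]
        have k2 : M * (-z) ≤ M * (1 / 24 / X) := by linarith [hz.1, hu.2]
        exact abs_le.2 ⟨by linarith [le_of_mul_le_mul_left k2 hMr], le_of_mul_le_mul_left k1 hMr⟩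
      refine hW _ (diff _ _ _ m3' m3) (diff _ _ _ m1' ?_) (diff _ _ _ m2' ?_) (diff _ _ _ m4' ?_)
      · convert m1 using 1; ring
      · convert m2 using 1; ring
      · convert m4 using 1; ring
    · intro i hi j hj hij
      obtain ⟨e1, e2, e3, e4⟩ := hw i hi
      obtain ⟨f1, f2, f3, f4⟩ := hw j hj
      apply shearedPoint_injective a1 a2 a4 r1 r2
      change G i = G j
      rw [hij] at e1 e2 e3 e4
      exact Prod.ext (e1.trans f1.symm) (Prod.ext (e2.trans f2.symm)
        (Prod.ext (e3.trans f3.symm) (e4.trans f4.symm)))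
  have hEtot : ∑ x, E x = (M : ℝ) ^ 4 * V.card := by
    have inj := latticeChar_injOn M V hMV
    have := sum_norm_sq_sum_addChar (V.image (latticeChar M))
    rw [Finset.card_image_of_injOn inj] at this
    simp only [Finset.sum_image inj] at this
    rw [hE, this]
    simp only [Fintype.card_prod, ZMod.card]
    push_cast
    ring
  have hE0 : ∀ x, 0 ≤ E x := fun x => by positivity
  have main : I.card * ((V.card : ℝ) / 2) ^ 2 ≤ W.card * ((M : ℝ) ^ 4 * V.card) := by
    calc I.card * ((V.card : ℝ) / 2) ^ 2 = ∑ _i ∈ I, ((V.card : ℝ) / 2) ^ 2 := by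
          rw [Finset.sum_const, nsmul_eq_mul]
      _ ≤ ∑ i ∈ I, E (red (G i)) := Finset.sum_le_sum hlow
      _ = ∑ x, ∑ i ∈ I.filter (fun i => red (G i) = x), E (red (G i)) :=
          (Finset.sum_fiberwise _ _ _).symm
      _ = ∑ x, ((I.filter fun i => red (G i) = x).card : ℝ) * E x := by
          refine Finset.sum_congr rfl fun x _ => ?_
          rw [Finset.sum_congr rfl (g := fun _ => E x)
            (fun i hi => by rw [(Finset.mem_filter.1 hi).2])]
          rw [Finset.sum_const, nsmul_eq_mul]
      _ ≤ ∑ x, (W.card : ℝ) * E x :=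
          Finset.sum_le_sum fun x _ => mul_le_mul_of_nonneg_right (hfib x) (hE0 x)
      _ = _ := by rw [← Finset.mul_sum, hEtot]
  rcases V.eq_empty_or_nonempty with hVe | hVne
  · rw [hVe]; simp; positivity
  have hVpos : (0 : ℝ) < V.card := by exact_mod_cast hVne.card_pos
  have hIpos : (0 : ℝ) < I.card := by
    by_contra hcon
    have : (I.card : ℝ) = 0 := le_antisymm (not_lt.1 hcon) (by positivity)
    rw [this] at hIcard
    have : (0 : ℝ) < (M : ℝ) ^ 4 := by positivity
    linarith
  have main2 : I.card * (V.card : ℝ) ≤ 4 * W.card * (M : ℝ) ^ 4 := by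
    have : V.card * (I.card * (V.card : ℝ)) ≤ V.card * (4 * W.card * (M : ℝ) ^ 4) := by nlinarith
    exact le_of_mul_le_mul_left this hVpos
  have main3 : I.card * (V.card : ℝ) ≤
      I.card * (4 * 48 ^ 4 * (X0 * X1 ^ 2 * X3) * W.card) := by
    calc I.card * (V.card : ℝ) ≤ 4 * W.card * (M : ℝ) ^ 4 := main2
      _ ≤ 4 * W.card * (48 ^ 4 * (X0 * X1 ^ 2 * X3) * I.card) := by gcongr
      _ = _ := by ring
  exact le_of_mul_le_mul_left main3 hIpos

theorem rpow_mem_Icc (γ K : ℝ) (hK : 1 ≤ K) {x : ℝ} (hx : x ∈ Set.Icc (1 / K) K) :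
    x ^ γ ∈ Set.Icc (1 / K ^ |γ|) (K ^ |γ|) := by
  have hK0 : 0 < K := by linarith
  have hx0 : 0 < x := lt_of_lt_of_le (by positivity) hx.1
  have hinv : x⁻¹ ≤ K := by
    have := inv_anti₀ (by positivity) hx.1
    simpa using this
  rcases le_total 0 γ with h | h
  · rw [abs_of_nonneg h]
    refine ⟨?_, Real.rpow_le_rpow hx0.le hx.2 h⟩
    rw [one_div, ← Real.inv_rpow hK0.le]
    exact Real.rpow_le_rpow (by positivity) (by simpa using hx.1) h
  · rw [abs_of_nonpos h, Real.rpow_neg hK0.le]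
    have e : x ^ γ = (x⁻¹) ^ (-γ) := by rw [Real.inv_rpow hx0.le, Real.rpow_neg hx0.le, inv_inv]
    constructor
    · simpa using Real.rpow_le_rpow_of_nonpos hx0 hx.2 h
    · rw [e, ← Real.rpow_neg hK0.le]
      exact Real.rpow_le_rpow (by positivity) hinv (by linarith)

theorem exists_lipschitz_rpow (γ K : ℝ) (hK : 1 ≤ K) :
    ∃ C : ℝ, 0 < C ∧ ∀ x ∈ Set.Icc (1 / K) K, ∀ y ∈ Set.Icc (1 / K) K,
      |x ^ γ - y ^ γ| ≤ C * |x - y| := by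
  have hK0 : 0 < K := by linarith
  refine ⟨|γ| * K ^ |γ - 1| + 1, by positivity, fun x hx y hy => ?_⟩
  have hpos : ∀ z ∈ Set.Icc (1 / K) K, 0 < z := fun z hz => lt_of_lt_of_le (by positivity) hz.1
  refine (convex_Icc (1 / K) K).norm_image_sub_le_of_norm_hasDerivWithin_le
    (f := fun z => z ^ γ) (f' := fun z => γ * z ^ (γ - 1)) (fun z hz =>
      (Real.hasDerivAt_rpow_const (Or.inl (hpos z hz).ne')).hasDerivWithinAt)
    (fun z hz => ?_) hy hx
  rw [norm_mul, Real.norm_eq_abs, Real.norm_eq_abs,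
    abs_of_pos (Real.rpow_pos_of_pos (hpos z hz) _)]
  have := mul_le_mul_of_nonneg_left (rpow_mem_Icc (γ - 1) K hK hz).2 (abs_nonneg γ)
  linarith

theorem exists_antilipschitz_rpow (γ K : ℝ) (hγ : γ ≠ 0) (hK : 1 ≤ K) :
    ∃ C : ℝ, 0 < C ∧ ∀ x ∈ Set.Icc (1 / K) K, ∀ y ∈ Set.Icc (1 / K) K,
      |x - y| ≤ C * |x ^ γ - y ^ γ| := by
  have hK0 : 0 < K := by linarith
  obtain ⟨C, hC, h⟩ := exists_lipschitz_rpow γ⁻¹ (K ^ |γ|) (Real.one_le_rpow hK (abs_nonneg _))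
  refine ⟨C, hC, fun x hx y hy => ?_⟩
  have := h _ (rpow_mem_Icc γ K hK hx) _ (rpow_mem_Icc γ K hK hy)
  rwa [Real.rpow_rpow_inv (le_trans (by positivity) hx.1) hγ,
    Real.rpow_rpow_inv (le_trans (by positivity) hy.1) hγ] at this

theorem exists_taylor_rpow (γ K : ℝ) (hK : 1 ≤ K) :
    ∃ C : ℝ, 0 < C ∧ ∀ x ∈ Set.Icc (1 / K) K, ∀ y ∈ Set.Icc (1 / K) K,
      |x ^ γ - y ^ γ - γ * y ^ (γ - 1) * (x - y)| ≤ C * (x - y) ^ 2 := by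
  have hK0 : 0 < K := by linarith
  obtain ⟨C, hC, h⟩ := exists_lipschitz_rpow (γ - 1) K hK
  refine ⟨|γ| * C + 1, by positivity, fun x hx y hy => ?_⟩
  have hsub : Set.uIcc y x ⊆ Set.Icc (1 / K) K := Set.uIcc_subset_Icc hy hx
  have hpos : ∀ z ∈ Set.Icc (1 / K) K, 0 < z := fun z hz => lt_of_lt_of_le (by positivity) hz.1
  have key := (convex_uIcc y x).norm_image_sub_le_of_norm_hasDerivWithin_le
    (f := fun z => z ^ γ - γ * y ^ (γ - 1) * z)
    (f' := fun z => γ * z ^ (γ - 1) - γ * y ^ (γ - 1) * 1) (C := |γ| * C * |x - y|)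
    (fun z hz => ((Real.hasDerivAt_rpow_const (Or.inl (hpos z (hsub hz)).ne')).sub
      ((hasDerivAt_id z).const_mul _)).hasDerivWithinAt)
    (fun z hz => ?_) Set.left_mem_uIcc Set.right_mem_uIcc
  · rw [Real.norm_eq_abs, Real.norm_eq_abs] at key
    calc _ = |x ^ γ - γ * y ^ (γ - 1) * x - (y ^ γ - γ * y ^ (γ - 1) * y)| := by
          congr 1; ring
      _ ≤ |γ| * C * |x - y| * |x - y| := key
      _ = |γ| * C * (x - y) ^ 2 := by rw [mul_assoc, abs_mul_abs_self]; ring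
      _ ≤ _ := by nlinarith [sq_nonneg (x - y)]
  · rw [Real.norm_eq_abs, mul_one, ← mul_sub, abs_mul, mul_assoc]
    refine mul_le_mul_of_nonneg_left ((h z (hsub hz) y hy).trans ?_) (abs_nonneg _)
    exact mul_le_mul_of_nonneg_left (Set.abs_sub_left_of_mem_uIcc hz) hC.le

theorem Icc_inv_subset {K L x : ℝ} (hK : 1 ≤ K) (hKL : K ≤ L) (hx : x ∈ Set.Icc (1 / K) K) :
    x ∈ Set.Icc (1 / L) L :=
  ⟨(one_div_le_one_div_of_le (by linarith) hKL).trans hx.1, hx.2.trans hKL⟩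

theorem div_mem_Icc {K x y : ℝ} (hK : 1 ≤ K) (hx : x ∈ Set.Icc (1 / K) K)
    (hy : y ∈ Set.Icc (1 / K) K) : x / y ∈ Set.Icc (1 / K ^ 2) (K ^ 2) := by
  have hK0 : 0 < K := by linarith
  have hy0 : 0 < y := lt_of_lt_of_le (by positivity) hy.1
  have hx0 : 0 < x := lt_of_lt_of_le (by positivity) hx.1
  have h1 : 1 ≤ K * y := by have := hy.1; rw [div_le_iff₀ hK0] at this; linarith
  have h2 : 1 ≤ K * x := by have := hx.1; rw [div_le_iff₀ hK0] at this; linarith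
  constructor
  · rw [div_le_div_iff₀ (by positivity) hy0]
    nlinarith [hy.2]
  · rw [div_le_iff₀ hy0]
    nlinarith [hx.2]

set_option maxHeartbeats 1000000 in
/-- The linearisation of the cone `x₁ ^ α + x₂ ^ α = x₃ ^ α + 1` at a nearby point `r` of it. -/
theorem exists_tangent_plane (α K : ℝ) (hα : α ≠ 0) (hK : 1 ≤ K) :
    ∃ L C c : ℝ, 1 ≤ L ∧ 0 < C ∧ 0 < c ∧ c ≤ 1 ∧ ∀ η : ℝ, 0 < η → η ≤ c →
      ∀ x₁ ∈ Set.Icc (1 / K) K, ∀ x₂ ∈ Set.Icc (1 / K) K, ∀ x₃ ∈ Set.Icc (1 / K) K,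
      ∀ r₁ r₂ : ℝ, |x₁ - r₁| ≤ η → |x₂ - r₂| ≤ η →
      |x₁ ^ α + x₂ ^ α - x₃ ^ α - 1| ≤ K * η ^ 2 →
      ∀ r₃ : ℝ, r₃ = (r₁ ^ α + r₂ ^ α - 1) ^ α⁻¹ →
      r₁ ∈ Set.Icc (1 / L) L ∧ r₂ ∈ Set.Icc (1 / L) L ∧ r₃ ∈ Set.Icc (1 / L) L ∧
      r₁ ^ α + r₂ ^ α = r₃ ^ α + 1 ∧
      |(r₁ / r₃) ^ (α - 1) * x₁ + (r₂ / r₃) ^ (α - 1) * x₂ - (1 / r₃) ^ (α - 1) - x₃| ≤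
        C * η ^ 2 := by
  have hK0 : 0 < K := by linarith
  obtain ⟨C1, hC1, lip⟩ := exists_lipschitz_rpow α (2 * K) (by linarith)
  set A : ℝ := 2 * K ^ |α| with hA
  have hKa : 1 ≤ K ^ |α| := Real.one_le_rpow hK (abs_nonneg _)
  have hA1 : 1 ≤ A := by linarith
  set L : ℝ := max (2 * K) (A ^ |α⁻¹|) with hL
  have hL2 : 2 * K ≤ L := le_max_left _ _
  have hL1 : 1 ≤ L := by linarith
  have hL0 : 0 < L := by linarith
  obtain ⟨C2, hC2, lip2⟩ := exists_lipschitz_rpow α⁻¹ A hA1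
  obtain ⟨C3, hC3, tay⟩ := exists_taylor_rpow α L hL1
  set B : ℝ := 2 * C1 + K with hB
  have hB0 : 0 < B := by positivity
  set D : ℝ := (K + C3 * (2 + (C2 * B) ^ 2)) / |α| * L ^ |α - 1| with hD
  have hα0 : 0 < |α| := abs_pos.2 hα
  have hD0 : 0 < D := by positivity
  refine ⟨L, D, min (1 / (2 * K)) (1 / (A * B)), hL1, hD0,
    by positivity, ?_, ?_⟩
  · refine (min_le_left _ _).trans ?_
    rw [div_le_one (by positivity)]; linarith
  intro η hη hηc x₁ hx₁ x₂ hx₂ x₃ hx₃ r₁ r₂ hr₁ hr₂ hx r₃ hr₃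
  have hη1 : η ≤ 1 / (2 * K) := hηc.trans (min_le_left _ _)
  have hη2 : η ≤ 1 / (A * B) := hηc.trans (min_le_right _ _)
  have hηone : η ≤ 1 := by
    refine hη1.trans ?_
    rw [div_le_one (by positivity)]; linarith
  have hrange : ∀ x r : ℝ, x ∈ Set.Icc (1 / K) K → |x - r| ≤ η → r ∈ Set.Icc (1 / (2 * K)) (2 * K) := by
    intro x r hx hr
    rw [abs_le] at hr
    have : 1 / K = 2 * (1 / (2 * K)) := by field_simp
    rw [Set.mem_Icc] at *
    constructor <;> linarith [hr.1, hr.2]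
  have R1 := hrange _ _ hx₁ hr₁
  have R2 := hrange _ _ hx₂ hr₂
  have up : ∀ x ∈ Set.Icc (1 / K) K, x ∈ Set.Icc (1 / (2 * K)) (2 * K) := fun x hx =>
    Icc_inv_subset hK (by linarith) hx
  have l1 := lip _ (up _ hx₁) _ R1
  have l2 := lip _ (up _ hx₂) _ R2
  set ρ := r₁ ^ α + r₂ ^ α - 1 with hρ
  have hρx : |ρ - x₃ ^ α| ≤ B * η := by
    have e : ρ - x₃ ^ α = (x₁ ^ α + x₂ ^ α - x₃ ^ α - 1) - (x₁ ^ α - r₁ ^ α) - (x₂ ^ α - r₂ ^ α) := by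
      rw [hρ]; ring
    rw [e]
    have m1 : C1 * |x₁ - r₁| ≤ C1 * η := by gcongr
    have m2 : C1 * |x₂ - r₂| ≤ C1 * η := by gcongr
    have m3 : K * η ^ 2 ≤ K * η := by gcongr; nlinarith
    rw [abs_le] at *
    constructor <;> linarith [l1.1, l1.2, l2.1, l2.2, hx.1, hx.2]
  have hBη : B * η ≤ 1 / A := by
    calc B * η ≤ B * (1 / (A * B)) := by gcongr
      _ = 1 / A := by field_simp
  have hx3a := rpow_mem_Icc α K hK hx₃
  have hx3A : x₃ ^ α ∈ Set.Icc (1 / A) A := Icc_inv_subset hKa (by linarith) hx3a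
  have hρA : ρ ∈ Set.Icc (1 / A) A := by
    have e : 1 / K ^ |α| = 2 * (1 / A) := by rw [hA]; field_simp
    have e2 : 1 / A ≤ 1 := by rw [div_le_one (by linarith)]; exact hA1
    rw [abs_le] at hρx
    rw [Set.mem_Icc] at *
    constructor <;> linarith [hρx.1, hρx.2, hx3a.1, hx3a.2]
  have hρ0 : 0 < ρ := lt_of_lt_of_le (by positivity) hρA.1
  have hr3A := rpow_mem_Icc α⁻¹ A hA1 hρA
  rw [← hr₃] at hr3A
  have R3 : r₃ ∈ Set.Icc (1 / L) L :=
    Icc_inv_subset (Real.one_le_rpow hA1 (abs_nonneg _)) (le_max_right _ _) hr3A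
  have hr3a : r₃ ^ α = ρ := by rw [hr₃, Real.rpow_inv_rpow hρ0.le hα]
  have hx30 : 0 < x₃ := lt_of_lt_of_le (by positivity) hx₃.1
  have hx3r : |x₃ - r₃| ≤ C2 * B * η := by
    have := lip2 _ hx3A _ hρA
    rw [Real.rpow_rpow_inv hx30.le hα, ← hr₃] at this
    rw [abs_sub_comm (x₃ ^ α)] at this
    calc _ ≤ _ := this
      _ ≤ C2 * (B * η) := by gcongr
      _ = _ := by ring
  have R1' : r₁ ∈ Set.Icc (1 / L) L := Icc_inv_subset (by linarith) hL2 R1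
  have R2' : r₂ ∈ Set.Icc (1 / L) L := Icc_inv_subset (by linarith) hL2 R2
  have r10 : 0 < r₁ := lt_of_lt_of_le (by positivity) R1'.1
  have r20 : 0 < r₂ := lt_of_lt_of_le (by positivity) R2'.1
  have r30 : 0 < r₃ := lt_of_lt_of_le (by positivity) R3.1
  have cone : r₁ ^ α + r₂ ^ α = r₃ ^ α + 1 := by rw [hr3a, hρ]; ring
  refine ⟨R1', R2', R3, cone, ?_⟩
  have upL : ∀ x ∈ Set.Icc (1 / K) K, x ∈ Set.Icc (1 / L) L := fun x hx =>
    Icc_inv_subset hK (by linarith) hx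
  have t1 := tay _ (upL _ hx₁) _ R1'
  have t2 := tay _ (upL _ hx₂) _ R2'
  have t3 := tay _ (upL _ hx₃) _ R3
  have sq_le : ∀ u v : ℝ, |u| ≤ v → u ^ 2 ≤ v ^ 2 := fun u v h => sq_le_sq' (abs_le.1 h).1 (abs_le.1 h).2
  have s1 := mul_le_mul_of_nonneg_left (sq_le _ _ hr₁) hC3.le
  have s2 := mul_le_mul_of_nonneg_left (sq_le _ _ hr₂) hC3.le
  have s3 := mul_le_mul_of_nonneg_left (sq_le _ _ hx3r) hC3.le
  have main : |α * (r₁ ^ (α - 1) * (x₁ - r₁) + r₂ ^ (α - 1) * (x₂ - r₂) - r₃ ^ (α - 1) * (x₃ - r₃))| ≤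
      (K + C3 * (2 + (C2 * B) ^ 2)) * η ^ 2 := by
    have e : (K + C3 * (2 + (C2 * B) ^ 2)) * η ^ 2 =
        K * η ^ 2 + C3 * η ^ 2 + C3 * η ^ 2 + C3 * (C2 * B * η) ^ 2 := by ring
    rw [e]
    rw [abs_le] at hx t1 t2 t3 ⊢
    constructor <;> linarith [t1.1, t1.2, t2.1, t2.2, t3.1, t3.2, hx.1, hx.2]
  have pw : ∀ r : ℝ, 0 < r → r ^ α = r ^ (α - 1) * r := by
    intro r hr
    rw [Real.rpow_sub_one hr.ne', div_mul_cancel₀ _ hr.ne']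
  have dv : ∀ r : ℝ, 0 < r → (r / r₃) ^ (α - 1) = r ^ (α - 1) / r₃ ^ (α - 1) := fun r hr =>
    Real.div_rpow hr.le r30.le _
  have r3pos : 0 < r₃ ^ (α - 1) := Real.rpow_pos_of_pos r30 _
  have e : (r₁ / r₃) ^ (α - 1) * x₁ + (r₂ / r₃) ^ (α - 1) * x₂ - (1 / r₃) ^ (α - 1) - x₃ =
      (α * (r₁ ^ (α - 1) * (x₁ - r₁) + r₂ ^ (α - 1) * (x₂ - r₂) - r₃ ^ (α - 1) * (x₃ - r₃))) /
        α / r₃ ^ (α - 1) := by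
    rw [dv _ r10, dv _ r20, dv _ one_pos, Real.one_rpow]
    rw [pw _ r10, pw _ r20, pw _ r30] at cone
    field_simp
    linear_combination cone
  rw [e, abs_div, abs_div, abs_of_pos r3pos, div_div, div_le_iff₀ (by positivity)]
  have hl : 1 ≤ L ^ |α - 1| * r₃ ^ (α - 1) := by
    have := (rpow_mem_Icc (α - 1) L hL1 R3).1
    rwa [div_le_iff₀ (by positivity), mul_comm] at this
  refine main.trans ?_
  have e2 : D * η ^ 2 * (|α| * r₃ ^ (α - 1)) =
      (K + C3 * (2 + (C2 * B) ^ 2)) * η ^ 2 * (L ^ |α - 1| * r₃ ^ (α - 1)) := by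
    rw [hD]; field_simp
  rw [e2]
  exact le_mul_of_one_le_right (by positivity) hl

theorem abs_div_sub_div_le {L x y μ ν φ : ℝ} (hL1 : 1 ≤ L) (hx : x ∈ Set.Icc (1 / L) L)
    (hy : y ∈ Set.Icc (1 / L) L) (hν : ν ∈ Set.Icc (1 / L) L) (h : |μ - x| ≤ φ)
    (h' : |ν - y| ≤ φ) : |x / y - μ / ν| ≤ 2 * L ^ 3 * φ := by
  have hL0 : 0 < L := by linarith
  have hφ : 0 ≤ φ := (abs_nonneg _).trans h
  have hx0 : 0 < x := lt_of_lt_of_le (by positivity) hx.1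
  have hy0 : 0 < y := lt_of_lt_of_le (by positivity) hy.1
  have hν0 : 0 < ν := lt_of_lt_of_le (by positivity) hν.1
  have e : x / y - μ / ν = (x * (ν - y) - y * (μ - x)) / (y * ν) := by
    field_simp; ring
  have low : 1 ≤ L ^ 2 * (y * ν) := by
    have p := hy.1
    have q := hν.1
    rw [div_le_iff₀ hL0] at p q
    nlinarith
  rw [e, abs_div, abs_of_pos (by positivity : 0 < y * ν), div_le_iff₀ (by positivity)]
  have n1 : |x * (ν - y)| ≤ L * φ := by
    rw [abs_mul, abs_of_pos hx0]
    exact mul_le_mul hx.2 h' (abs_nonneg _) hL0.le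
  have n2 : |y * (μ - x)| ≤ L * φ := by
    rw [abs_mul, abs_of_pos hy0]
    exact mul_le_mul hy.2 h (abs_nonneg _) hL0.le
  calc _ ≤ |x * (ν - y)| + |y * (μ - x)| := abs_sub _ _
    _ ≤ 2 * L * φ := by linarith
    _ ≤ 2 * L * φ * (L ^ 2 * (y * ν)) := le_mul_of_one_le_right (by positivity) low
    _ = _ := by ring

set_option maxHeartbeats 1000000 in
/-- A direction `μ` almost normal to the cone with exponent `α` at `r` lies close to the dual cone,
whose exponent is conjugate to `α`, and determines `r` up to a small error. -/
theorem exists_near_dual_cone (α β K : ℝ) (hα1 : α ≠ 1) (hβ : β = α / (α - 1))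
    (hK : 1 ≤ K) :
    ∃ C : ℝ, 0 < C ∧ ∀ r₁ ∈ Set.Icc (1 / K) K, ∀ r₂ ∈ Set.Icc (1 / K) K,
      ∀ r₃ ∈ Set.Icc (1 / K) K, r₁ ^ α + r₂ ^ α = r₃ ^ α + 1 →
      ∀ μ₁ ∈ Set.Icc (1 / K) K, ∀ μ₂ ∈ Set.Icc (1 / K) K, ∀ μ₄ ∈ Set.Icc (1 / K) K,
      ∀ φ : ℝ, |μ₁ - (r₁ / r₃) ^ (α - 1)| ≤ φ → |μ₂ - (r₂ / r₃) ^ (α - 1)| ≤ φ →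
      |μ₄ - (1 / r₃) ^ (α - 1)| ≤ φ →
      |μ₁ ^ β + μ₂ ^ β - 1 - μ₄ ^ β| ≤ C * (|r₁ * μ₁ + r₂ * μ₂ - r₃ - μ₄| + φ ^ 2) ∧
      |r₁ - (μ₁ / μ₄) ^ (α - 1)⁻¹| ≤ C * φ ∧ |r₂ - (μ₂ / μ₄) ^ (α - 1)⁻¹| ≤ C * φ := by
  have hK0 : 0 < K := by linarith
  have hα1' : α - 1 ≠ 0 := sub_ne_zero.2 hα1
  set L : ℝ := max K ((K ^ 2) ^ |α - 1|) with hL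
  have hKL : K ≤ L := le_max_left _ _
  have hL1 : 1 ≤ L := by linarith
  have hL0 : 0 < L := by linarith
  obtain ⟨C3, hC3, tay⟩ := exists_taylor_rpow β L hL1
  obtain ⟨C1, hC1, lip⟩ := exists_lipschitz_rpow (α - 1)⁻¹ (L ^ 2) (by nlinarith)
  set C := max (|β| * K + 3 * C3) (C1 * (2 * L ^ 3)) with hC
  refine ⟨C, lt_max_of_lt_left (by positivity), ?_⟩
  intro r₁ hr₁ r₂ hr₂ r₃ hr₃ cone μ₁ hμ₁ μ₂ hμ₂ μ₄ hμ₄ φ h1 h2 h4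
  have pos : ∀ x ∈ Set.Icc (1 / K) K, 0 < x := fun x hx => lt_of_lt_of_le (by positivity) hx.1
  have r10 := pos _ hr₁
  have r20 := pos _ hr₂
  have r30 := pos _ hr₃
  have one_mem : (1 : ℝ) ∈ Set.Icc (1 / K) K := ⟨by rw [div_le_one hK0]; exact hK, hK⟩
  have hφ : 0 ≤ φ := (abs_nonneg _).trans h1
  have upL : ∀ x ∈ Set.Icc (1 / K) K, x ∈ Set.Icc (1 / L) L := fun x hx =>
    Icc_inv_subset hK hKL hx
  have amem : ∀ r ∈ Set.Icc (1 / K) K, (r / r₃) ^ (α - 1) ∈ Set.Icc (1 / L) L := fun r hr =>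
    Icc_inv_subset (Real.one_le_rpow (by nlinarith) (abs_nonneg _)) (le_max_right _ _)
      (rpow_mem_Icc (α - 1) (K ^ 2) (by nlinarith) (div_mem_Icc hK hr hr₃))
  have a1 := amem _ hr₁
  have a2 := amem _ hr₂
  have a4 := amem _ one_mem
  have posL : ∀ x ∈ Set.Icc (1 / L) L, 0 < x := fun x hx => lt_of_lt_of_le (by positivity) hx.1
  have pβ : ∀ r, 0 < r → ((r / r₃) ^ (α - 1)) ^ β = (r / r₃) ^ α := by
    intro r hr
    rw [← Real.rpow_mul (by positivity), hβ]
    congr 1; field_simp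
  have pβ1 : ∀ r, 0 < r → ((r / r₃) ^ (α - 1)) ^ (β - 1) = r / r₃ := by
    intro r hr
    rw [← Real.rpow_mul (by positivity), hβ]
    have : (α - 1) * (α / (α - 1) - 1) = 1 := by field_simp; ring
    rw [this, Real.rpow_one]
  have t1 := tay _ (upL _ hμ₁) _ a1
  have t2 := tay _ (upL _ hμ₂) _ a2
  have t4 := tay _ (upL _ hμ₄) _ a4
  rw [pβ _ r10, pβ1 _ r10] at t1
  rw [pβ _ r20, pβ1 _ r20] at t2
  rw [pβ _ one_pos, pβ1 _ one_pos] at t4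
  have sq_le : ∀ u : ℝ, |u| ≤ φ → u ^ 2 ≤ φ ^ 2 := fun u h => sq_le_sq' (abs_le.1 h).1 (abs_le.1 h).2
  have s1 := mul_le_mul_of_nonneg_left (sq_le _ h1) hC3.le
  have s2 := mul_le_mul_of_nonneg_left (sq_le _ h2) hC3.le
  have s4 := mul_le_mul_of_nonneg_left (sq_le _ h4) hC3.le
  have cone' : (r₁ / r₃) ^ α + (r₂ / r₃) ^ α - 1 - (1 / r₃) ^ α = 0 := by
    rw [Real.div_rpow r10.le r30.le, Real.div_rpow r20.le r30.le, Real.div_rpow one_pos.le r30.le,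
      Real.one_rpow]
    have := Real.rpow_pos_of_pos r30 α
    field_simp
    linarith
  have pw : ∀ r, 0 < r → (r / r₃) ^ α = (r / r₃) ^ (α - 1) * (r / r₃) := by
    intro r hr
    have : r / r₃ ≠ 0 := by positivity
    rw [Real.rpow_sub_one this, div_mul_cancel₀ _ this]
  refine ⟨?_, ?_, ?_⟩
  · have lin : β * (r₁ / r₃) * (μ₁ - (r₁ / r₃) ^ (α - 1)) + β * (r₂ / r₃) * (μ₂ - (r₂ / r₃) ^ (α - 1))
        - β * (1 / r₃) * (μ₄ - (1 / r₃) ^ (α - 1)) =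
        β * (1 / r₃) * (r₁ * μ₁ + r₂ * μ₂ - r₃ - μ₄) := by
      have c := cone'
      rw [pw _ r10, pw _ r20, pw _ one_pos] at c
      have e : r₃ / r₃ = 1 := div_self r30.ne'
      linear_combination -β * c + β * e
    have hb : |β * (1 / r₃) * (r₁ * μ₁ + r₂ * μ₂ - r₃ - μ₄)| ≤
        |β| * K * |r₁ * μ₁ + r₂ * μ₂ - r₃ - μ₄| := by
      rw [abs_mul, abs_mul]
      gcongr
      rw [abs_of_pos (by positivity), div_le_iff₀ r30]
      have := hr₃.1
      rw [div_le_iff₀ hK0] at this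
      linarith
    have hfin : |μ₁ ^ β + μ₂ ^ β - 1 - μ₄ ^ β| ≤
        |β| * K * |r₁ * μ₁ + r₂ * μ₂ - r₃ - μ₄| + 3 * C3 * φ ^ 2 := by
      rw [← lin] at hb
      rw [abs_le] at t1 t2 t4 hb ⊢
      constructor <;> linarith [t1.1, t1.2, t2.1, t2.2, t4.1, t4.2, hb.1, hb.2]
    have hCl : |β| * K + 3 * C3 ≤ C := le_max_left _ _
    have hT := abs_nonneg (r₁ * μ₁ + r₂ * μ₂ - r₃ - μ₄)
    have hbK : 0 ≤ |β| * K := by positivity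
    refine hfin.trans ?_
    nlinarith [sq_nonneg φ, mul_nonneg hbK (sq_nonneg φ), mul_nonneg hC3.le hT,
      mul_le_mul_of_nonneg_right hCl (add_nonneg hT (sq_nonneg φ))]
  all_goals
    have key : ∀ r ∈ Set.Icc (1 / K) K, ∀ μ ∈ Set.Icc (1 / K) K, |μ - (r / r₃) ^ (α - 1)| ≤ φ →
        |r - (μ / μ₄) ^ (α - 1)⁻¹| ≤ C * φ := by
      intro r hr μ hμ h
      have r0 := pos _ hr
      have a := amem _ hr
      have l := lip _ (div_mem_Icc hL1 a a4) _ (div_mem_Icc hL1 (upL _ hμ) (upL _ hμ₄))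
      have e : ((r / r₃) ^ (α - 1) / (1 / r₃) ^ (α - 1)) ^ (α - 1)⁻¹ = r := by
        rw [← Real.div_rpow (by positivity) (by positivity), Real.rpow_rpow_inv (by positivity) hα1']
        field_simp
      rw [e] at l
      have hq : |(r / r₃) ^ (α - 1) / (1 / r₃) ^ (α - 1) - μ / μ₄| ≤ 2 * L ^ 3 * φ := by
        exact abs_div_sub_div_le hL1 a a4 (upL _ hμ₄) h h4
      calc _ ≤ _ := l
        _ ≤ C1 * (2 * L ^ 3 * φ) := by gcongr
        _ = C1 * (2 * L ^ 3) * φ := by ring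
        _ ≤ _ := by gcongr; exact le_max_right _ _
  · exact key _ hr₁ _ hμ₁ h1
  · exact key _ hr₂ _ hμ₂ h2

/-- `n` is comparable to `N` in each coordinate and close to the cone
`n₁ ^ γ + n₂ ^ γ = n₃ ^ γ + n₄ ^ γ`. -/
def IsNearCone (γ κ N δ : ℝ) (n : ℤ × ℤ × ℤ × ℤ) : Prop :=
  (n.1 : ℝ) ∈ Set.Icc (N / κ) (κ * N) ∧ (n.2.1 : ℝ) ∈ Set.Icc (N / κ) (κ * N) ∧
    (n.2.2.1 : ℝ) ∈ Set.Icc (N / κ) (κ * N) ∧ (n.2.2.2 : ℝ) ∈ Set.Icc (N / κ) (κ * N) ∧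
    |(n.1 : ℝ) ^ γ + (n.2.1 : ℝ) ^ γ - (n.2.2.1 : ℝ) ^ γ - (n.2.2.2 : ℝ) ^ γ| ≤ δ * N ^ γ

theorem mem_Icc_div_of_mem_Icc {κ N x y : ℝ} (hκ : 1 ≤ κ) (hN : 0 < N)
    (hx : x ∈ Set.Icc (N / κ) (κ * N)) (hy : y ∈ Set.Icc (N / κ) (κ * N)) :
    x / y ∈ Set.Icc (1 / κ ^ 2) (κ ^ 2) := by
  have hκ0 : 0 < κ := by linarith
  have h : ∀ z ∈ Set.Icc (N / κ) (κ * N), z / N ∈ Set.Icc (1 / κ) κ := by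
    intro z hz
    constructor
    · rw [le_div_iff₀ hN]
      have := hz.1
      rwa [one_div_mul_eq_div]
    · rw [div_le_iff₀ hN]; exact hz.2
  have := div_mem_Icc hκ (h _ hx) (h _ hy)
  rwa [div_div_div_cancel_right₀ hN.ne'] at this

/-- Rescaling a point near the cone by its last coordinate. -/
theorem IsNearCone.rescale {α κ N δ : ℝ} (hκ : 1 ≤ κ) (hN : 0 < N) (hδ : 0 ≤ δ)
    {n : ℤ × ℤ × ℤ × ℤ} (hn : IsNearCone α κ N δ n) :
    |((n.1 : ℝ) / n.2.2.2) ^ α + ((n.2.1 : ℝ) / n.2.2.2) ^ α - ((n.2.2.1 : ℝ) / n.2.2.2) ^ α - 1| ≤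
      κ ^ |α| * δ := by
  obtain ⟨h1, h2, h3, h4, h⟩ := hn
  have hκ0 : 0 < κ := by linarith
  have pos : ∀ z ∈ Set.Icc (N / κ) (κ * N), 0 < z := fun z hz =>
    lt_of_lt_of_le (by positivity) hz.1
  have p1 := pos _ h1
  have p2 := pos _ h2
  have p3 := pos _ h3
  have p4 := pos _ h4
  have q := Real.rpow_pos_of_pos p4 α
  rw [Real.div_rpow p1.le p4.le, Real.div_rpow p2.le p4.le, Real.div_rpow p3.le p4.le]
  have e : (n.1 : ℝ) ^ α / (n.2.2.2 : ℝ) ^ α + (n.2.1 : ℝ) ^ α / (n.2.2.2 : ℝ) ^ α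
      - (n.2.2.1 : ℝ) ^ α / (n.2.2.2 : ℝ) ^ α - 1 =
      ((n.1 : ℝ) ^ α + (n.2.1 : ℝ) ^ α - (n.2.2.1 : ℝ) ^ α - (n.2.2.2 : ℝ) ^ α) /
        (n.2.2.2 : ℝ) ^ α := by field_simp
  rw [e, abs_div, abs_of_pos q, div_le_iff₀ q]
  have hr : N / n.2.2.2 ∈ Set.Icc (1 / κ) κ := by
    constructor
    · rw [div_le_div_iff₀ hκ0 p4]
      linarith [h4.2]
    · rw [div_le_iff₀ p4]
      have := h4.1
      rw [div_le_iff₀ hκ0] at this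
      linarith
  have hr' := (rpow_mem_Icc α κ hκ hr).2
  rw [Real.div_rpow hN.le p4.le, div_le_iff₀ q] at hr'
  calc _ ≤ _ := h
    _ ≤ δ * (κ ^ |α| * (n.2.2.2 : ℝ) ^ α) := by gcongr
    _ = _ := by ring

set_option maxHeartbeats 1000000 in
/-- A nonzero vector in the polar body of a cell is close to the dual cone. -/
theorem exists_isNearCone_of_polar (α β L B₀ : ℝ) (hα1 : α ≠ 1)
    (hβ : β = α / (α - 1)) (hL : 1 ≤ L) :
    ∃ B K : ℝ, B₀ ≤ B ∧ 1 ≤ B ∧ 1 ≤ K ∧ ∀ N δ : ℝ, 1 ≤ N → 0 < δ → δ ≤ 1 → 1 ≤ √δ * N →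
      ∀ r₁ ∈ Set.Icc (1 / L) L, ∀ r₂ ∈ Set.Icc (1 / L) L, ∀ r₃ ∈ Set.Icc (1 / L) L,
      r₁ ^ α + r₂ ^ α = r₃ ^ α + 1 →
      ∀ m₁ m₂ m₃ m₄ : ℤ, 0 ≤ m₃ → (m₃ : ℝ) ≤ 1 / 24 / (B * (δ * N)) →
      |(m₁ : ℝ) - (r₁ / r₃) ^ (α - 1) * m₃| ≤ 1 / 24 / (B * (√δ * N)) →
      |(m₂ : ℝ) - (r₂ / r₃) ^ (α - 1) * m₃| ≤ 1 / 24 / (B * (√δ * N)) →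
      |(m₄ : ℝ) - (1 / r₃) ^ (α - 1) * m₃ - r₁ * (m₁ - (r₁ / r₃) ^ (α - 1) * m₃) -
        r₂ * (m₂ - (r₂ / r₃) ^ (α - 1) * m₃)| ≤ 1 / 24 / (B * N) →
      (m₁ = 0 ∧ m₂ = 0 ∧ m₃ = 0 ∧ m₄ = 0) ∨
      (1 ≤ m₃ ∧ (m₃ : ℝ) ≤ K / (δ * N) ∧
        IsNearCone β K m₃ (K / (δ * N ^ 2 * m₃ ^ 2)) (m₁, m₂, m₃, m₄) ∧
        |r₁ - ((m₁ : ℝ) / m₄) ^ (α - 1)⁻¹| ≤ K / (√δ * N * m₃) ∧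
        |r₂ - ((m₂ : ℝ) / m₄) ^ (α - 1)⁻¹| ≤ K / (√δ * N * m₃)) := by
  have hL0 : 0 < L := by linarith
  set A : ℝ := (L ^ 2) ^ |α - 1| with hA
  have hA1 : 1 ≤ A := Real.one_le_rpow (by nlinarith) (abs_nonneg _)
  have hA0 : 0 < A := by linarith
  set K₁ : ℝ := 2 * A + L with hK₁
  have hK₁1 : 1 ≤ K₁ := by linarith
  have hK₁0 : 0 < K₁ := by linarith
  obtain ⟨C, hC, dual⟩ := exists_near_dual_cone α β K₁ hα1 hβ hK₁1
  set B : ℝ := max B₀ (L * A)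
  have hLA : L * A ≤ B := le_max_right _ _
  have hB1 : 1 ≤ B := (one_le_mul_of_one_le_of_one_le hL hA1).trans hLA
  have hLB : L ≤ B := (le_mul_of_one_le_right hL0.le hA1).trans hLA
  have hB0 : 0 < B := by linarith
  refine ⟨B, K₁ + 2 * C + 1, le_max_left _ _, hB1, by linarith, ?_⟩
  intro N δ hN hδ hδ1 hδN r₁ hr₁ r₂ hr₂ r₃ hr₃ cone m₁ m₂ m₃ m₄ hm hm3 h1 h2 h4
  have hN0 : 0 < N := by linarith
  set η := √δ with hη
  have hη0 : 0 < η := Real.sqrt_pos.2 hδ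
  have hη1 : η ≤ 1 := Real.sqrt_le_one.2 hδ1
  have hηδ : η ^ 2 = δ := Real.sq_sqrt hδ.le
  have posL : ∀ x ∈ Set.Icc (1 / L) L, 0 < x := fun x hx => lt_of_lt_of_le (by positivity) hx.1
  have r10 := posL _ hr₁
  have r20 := posL _ hr₂
  have r30 := posL _ hr₃
  have one_mem : (1 : ℝ) ∈ Set.Icc (1 / L) L := ⟨by rw [div_le_one hL0]; exact hL, hL⟩
  set a₁ := (r₁ / r₃) ^ (α - 1) with ha₁
  set a₂ := (r₂ / r₃) ^ (α - 1) with ha₂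
  set a₄ := (1 / r₃) ^ (α - 1) with ha₄
  have amem : ∀ r ∈ Set.Icc (1 / L) L, (r / r₃) ^ (α - 1) ∈ Set.Icc (1 / A) A := fun r hr =>
      (rpow_mem_Icc (α - 1) (L ^ 2) (by nlinarith) (div_mem_Icc hL hr hr₃))
  have am1 : a₁ ∈ Set.Icc (1 / A) A := amem _ hr₁
  have am2 : a₂ ∈ Set.Icc (1 / A) A := amem _ hr₂
  have am4 : a₄ ∈ Set.Icc (1 / A) A := amem _ one_mem
  set θ : ℝ := 1 / 24 / (B * (η * N)) with hθ
  have hθ0 : 0 < θ := by positivity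
  have hBN : 1 / 24 / (B * N) ≤ θ := by
    rw [hθ]
    gcongr
    exact mul_le_of_le_one_left hN0.le hη1
  have hθB : θ * B ≤ 1 / 24 := by
    have : θ * B * (η * N) = 1 / 24 := by rw [hθ]; field_simp
    nlinarith [mul_pos hθ0 hB0]
  have hθL : θ * L ≤ 1 / 24 := (mul_le_mul_of_nonneg_left hLB hθ0.le).trans hθB
  have hθ1 : θ ≤ 1 / 24 := (le_mul_of_one_le_right hθ0.le hL).trans hθL
  have h4' : |(m₄ : ℝ) - a₄ * m₃| ≤ 3 * (L * θ) := by
    have e : (m₄ : ℝ) - a₄ * m₃ = (m₄ - a₄ * m₃ - r₁ * (m₁ - a₁ * m₃) - r₂ * (m₂ - a₂ * m₃)) +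
      r₁ * (m₁ - a₁ * m₃) + r₂ * (m₂ - a₂ * m₃) := by ring
    rw [e]
    refine (abs_add_three _ _ _).trans ?_
    rw [abs_mul, abs_mul, abs_of_pos r10, abs_of_pos r20]
    have n1 : r₁ * |(m₁ : ℝ) - a₁ * m₃| ≤ L * θ :=
      mul_le_mul hr₁.2 h1 (abs_nonneg _) hL0.le
    have n2 : r₂ * |(m₂ : ℝ) - a₂ * m₃| ≤ L * θ :=
      mul_le_mul hr₂.2 h2 (abs_nonneg _) hL0.le
    have n3 : θ ≤ L * θ := le_mul_of_one_le_left hθ0.le hL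
    linarith
  have zero_of : ∀ z : ℤ, |(z : ℝ)| < 1 → z = 0 := by
    intro z hz
    exact Int.abs_lt_one_iff.1 (by exact_mod_cast hz)
  rcases hm.eq_or_lt with hm0 | hmpos
  · left
    subst hm0
    simp only [Int.cast_zero, mul_zero, sub_zero] at h1 h2 h4'
    refine ⟨zero_of _ (by linarith), zero_of _ (by linarith), rfl, zero_of _ (by linarith)⟩
  right
  have hm1 : 1 ≤ m₃ := hmpos
  set M : ℝ := (m₃ : ℝ) with hM
  have hM1 : 1 ≤ M := by rw [hM]; exact_mod_cast hm1
  have hM0 : 0 < M := by linarith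
  have dv : ∀ z a t : ℝ, |z - a * M| ≤ t → |z / M - a| ≤ t / M := by
    intro z a t h
    have : z / M - a = (z - a * M) / M := by field_simp
    rw [this, abs_div, abs_of_pos hM0]
    gcongr
  have range : ∀ z a : ℝ, a ∈ Set.Icc (1 / A) A → |z / M - a| ≤ 3 * (L * θ) / M →
      z / M ∈ Set.Icc (1 / (2 * A)) (2 * A) := by
    intro z a ha h
    have b : 3 * (L * θ) / M ≤ 1 / (2 * A) := by
      have : 3 * (L * θ) / M ≤ 3 * (L * θ) := div_le_self (by positivity) hM1
      refine this.trans ?_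
      rw [le_div_iff₀ (by positivity)]
      have e3 : θ * (L * A) ≤ θ * B := mul_le_mul_of_nonneg_left hLA hθ0.le
      linarith
    have e : 1 / A = 2 * (1 / (2 * A)) := by field_simp
    have e2 : 1 / (2 * A) ≤ 1 := by rw [div_le_one (by positivity)]; linarith
    have hh := abs_le.1 (h.trans b)
    have l := ha.1
    have u := ha.2
    rw [e] at l
    constructor <;> linarith [hh.1, hh.2]
  have hweak : θ / M ≤ 3 * (L * θ) / M := by
    gcongr
    linarith [le_mul_of_one_le_left hθ0.le hL]
  have d1 := (dv _ _ _ h1).trans hweak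
  have d2 := (dv _ _ _ h2).trans hweak
  have d4 := dv _ _ _ h4'
  have μ1 := range _ _ am1 d1
  have μ2 := range _ _ am2 d2
  have μ4 := range _ _ am4 d4
  have up2A : ∀ x ∈ Set.Icc (1 / (2 * A)) (2 * A), x ∈ Set.Icc (1 / K₁) K₁ := fun x hx =>
    Icc_inv_subset (by linarith) (by linarith) hx
  have upL : ∀ x ∈ Set.Icc (1 / L) L, x ∈ Set.Icc (1 / K₁) K₁ := fun x hx =>
    Icc_inv_subset hL (by linarith) hx
  obtain ⟨e1, e2, e3⟩ := dual _ (upL _ hr₁) _ (upL _ hr₂) _ (upL _ hr₃) cone _ (up2A _ μ1) _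
    (up2A _ μ2) _ (up2A _ μ4) _ d1 d2 d4
  have divdiv : ∀ x y : ℝ, x / M / (y / M) = x / y := fun x y => div_div_div_cancel_right₀ hM0.ne' x y
  rw [divdiv] at e2 e3
  have hLθ : 3 * (L * θ) ≤ 1 / (η * N) := by
    have : 3 * (L * θ) = (L / B) * (1 / 8) * (1 / (η * N)) := by rw [hθ]; field_simp; norm_num
    rw [this]
    have hq : L / B ≤ 1 := by rw [div_le_one hB0]; exact hLB
    have : (L / B) * (1 / 8) ≤ 1 := by linarith
    exact mul_le_of_le_one_left (by positivity) this
  have hϕ : C * (3 * (L * θ) / M) ≤ (K₁ + 2 * C + 1) / (η * N * M) := by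
    calc C * (3 * (L * θ) / M) ≤ C * (1 / (η * N) / M) := by gcongr
      _ = C / (η * N * M) := by field_simp
      _ ≤ _ := by gcongr; linarith
  have hMδ : δ * N * M ≤ 1 := by
    rw [le_div_iff₀ (by positivity)] at hm3
    have hh : M * (δ * N) ≤ M * (B * (δ * N)) := by
      exact mul_le_mul_of_nonneg_left (le_mul_of_one_le_left (by positivity) hB1) hM0.le
    linarith
  have scale : ∀ z : ℝ, z / M ∈ Set.Icc (1 / (2 * A)) (2 * A) →
      z ∈ Set.Icc (M / (K₁ + 2 * C + 1)) ((K₁ + 2 * C + 1) * M) := by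
    intro z hz
    have hz' := Icc_inv_subset (L := K₁ + 2 * C + 1) (by linarith) (by linarith) hz
    have l := hz'.1
    have u := hz'.2
    rw [div_le_iff₀ hM0] at u
    rw [le_div_iff₀ hM0, one_div_mul_eq_div] at l
    exact ⟨l, u⟩
  refine ⟨hm1, ?_, ⟨?_, ?_, ?_, ?_, ?_⟩, e2.trans hϕ, e3.trans hϕ⟩
  · rw [le_div_iff₀ (by positivity)]; linarith
  · exact scale _ μ1
  · exact scale _ μ2
  · refine scale _ ?_
    rw [div_self hM0.ne']
    exact ⟨by rw [div_le_one (by positivity)]; linarith, by linarith⟩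
  · exact scale _ μ4
  have μpos : ∀ z : ℝ, z / M ∈ Set.Icc (1 / (2 * A)) (2 * A) → 0 < z / M := fun z hz =>
    lt_of_lt_of_le (by positivity) hz.1
  have pw : ∀ z : ℝ, z / M ∈ Set.Icc (1 / (2 * A)) (2 * A) → z ^ β = (z / M) ^ β * M ^ β := by
    intro z hz
    rw [← Real.mul_rpow (μpos _ hz).le hM0.le, div_mul_cancel₀ _ hM0.ne']
  have eM : (m₁ : ℝ) ^ β + (m₂ : ℝ) ^ β - M ^ β - (m₄ : ℝ) ^ β =
      (((m₁ : ℝ) / M) ^ β + ((m₂ : ℝ) / M) ^ β - 1 - ((m₄ : ℝ) / M) ^ β) * M ^ β := by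
    rw [pw _ μ1, pw _ μ2, pw _ μ4]; ring
  change |(m₁ : ℝ) ^ β + (m₂ : ℝ) ^ β - M ^ β - (m₄ : ℝ) ^ β| ≤ _
  have hMβ := Real.rpow_pos_of_pos hM0 β
  rw [eM, abs_mul, abs_of_pos hMβ]
  refine mul_le_mul_of_nonneg_right (e1.trans ?_) hMβ.le
  have euler : r₁ * a₁ + r₂ * a₂ - r₃ - a₄ = 0 := by
    have pa : ∀ r : ℝ, 0 < r → r ^ α = r ^ (α - 1) * r := by
      intro r hr
      rw [Real.rpow_sub_one hr.ne', div_mul_cancel₀ _ hr.ne']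
    have r3pos : 0 < r₃ ^ (α - 1) := Real.rpow_pos_of_pos r30 _
    rw [ha₁, ha₂, ha₄, Real.div_rpow r10.le r30.le, Real.div_rpow r20.le r30.le,
      Real.div_rpow one_pos.le r30.le, Real.one_rpow]
    rw [pa _ r10, pa _ r20, pa _ r30] at cone
    field_simp
    linear_combination cone
  have hT : |r₁ * (m₁ / M) + r₂ * (m₂ / M) - r₃ - m₄ / M| ≤ 1 / (δ * N ^ 2 * M ^ 2) := by
    have e : r₁ * (m₁ / M) + r₂ * (m₂ / M) - r₃ - m₄ / M =
        -((m₄ - a₄ * M - r₁ * (m₁ - a₁ * M) - r₂ * (m₂ - a₂ * M)) / M) := by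
      field_simp
      linear_combination M * euler
    rw [e, abs_neg, abs_div, abs_of_pos hM0, div_le_iff₀ hM0]
    refine h4.trans ?_
    have e' : 1 / (δ * N ^ 2 * M ^ 2) * M = 1 / (δ * N * M) * (1 / N) := by field_simp
    rw [e']
    have one_le : 1 ≤ 1 / (δ * N * M) := by rw [le_div_iff₀ (by positivity)]; linarith
    have le_one : 1 / 24 / (B * N) ≤ 1 / N := by
      rw [div_div]
      gcongr
      have := le_mul_of_one_le_left hN0.le hB1
      linarith
    exact le_one.trans (le_mul_of_one_le_left (by positivity) one_le)
  have hφ2 : (3 * (L * θ) / M) ^ 2 ≤ 1 / (δ * N ^ 2 * M ^ 2) := by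
    have e : (1 / (η * N) / M) ^ 2 = 1 / (δ * N ^ 2 * M ^ 2) := by
      rw [← hηδ]; field_simp
    rw [← e]
    gcongr
  calc C * (|r₁ * (m₁ / M) + r₂ * (m₂ / M) - r₃ - m₄ / M| + (3 * (L * θ) / M) ^ 2)
      ≤ C * (1 / (δ * N ^ 2 * M ^ 2) + 1 / (δ * N ^ 2 * M ^ 2)) := by gcongr
    _ = 2 * C / (δ * N ^ 2 * M ^ 2) := by ring
    _ ≤ _ := by gcongr; linarith

/-- The dual points produced by a cell of width `√δ` on the cone of scale `N`. -/
def IsDualPoint (β K N δ : ℝ) (m : ℤ × ℤ × ℤ × ℤ) : Prop :=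
  1 ≤ m.2.2.1 ∧ (m.2.2.1 : ℝ) ≤ K / (δ * N) ∧
    IsNearCone β K m.2.2.1 (K / (δ * N ^ 2 * (m.2.2.1 : ℝ) ^ 2)) m

set_option maxHeartbeats 1000000 in
/-- The number of points of a cell is controlled by the number of associated dual points. -/
theorem exists_card_cell_le (α β κ : ℝ) (hα : α ≠ 0) (hα1 : α ≠ 1) (hβ : β = α / (α - 1))
    (hκ : 1 ≤ κ) :
    ∃ K C c : ℝ, 1 ≤ K ∧ 0 < C ∧ 0 < c ∧ c ≤ 1 ∧ ∀ N δ : ℝ, 1 ≤ N → 0 < δ → δ ≤ c → 1 ≤ √δ * N →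
      ∀ r₁ r₂ : ℝ, ∀ V D : Finset (ℤ × ℤ × ℤ × ℤ),
      (∀ n ∈ V, IsNearCone α κ N δ n ∧ |(n.1 : ℝ) / n.2.2.2 - r₁| ≤ √δ ∧
        |(n.2.1 : ℝ) / n.2.2.2 - r₂| ≤ √δ) →
      (∀ m, IsDualPoint β K N δ m →
        |r₁ - ((m.1 : ℝ) / m.2.2.2) ^ (α - 1)⁻¹| ≤ K / (√δ * N * m.2.2.1) →
        |r₂ - ((m.2.1 : ℝ) / m.2.2.2) ^ (α - 1)⁻¹| ≤ K / (√δ * N * m.2.2.1) → m ∈ D) →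
      (V.card : ℝ) ≤ C * (N ^ 4 * δ ^ 2) * (1 + 2 * D.card) := by
  have hκ0 : 0 < κ := by linarith
  have hκa : 1 ≤ κ ^ |α| := Real.one_le_rpow hκ (abs_nonneg _)
  set K₀ : ℝ := κ ^ 2 + κ ^ |α| with hK₀
  have hK₀1 : 1 ≤ K₀ := by nlinarith
  obtain ⟨L, T, c, hL, hT, hc, hc1, tangent⟩ := exists_tangent_plane α K₀ hα hK₀1
  obtain ⟨B, K, hB₀, hB1, hK, polar⟩ :=
    exists_isNearCone_of_polar α β L (κ * (1 + T)) hα1 hβ hL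
  have hB0 : 0 < B := by linarith
  have hκB : κ ≤ B := by nlinarith
  have hκTB : κ * T ≤ B := by nlinarith
  refine ⟨K, 4 * 48 ^ 4 * B ^ 4, c ^ 2, hK, by positivity, by positivity, by nlinarith, ?_⟩
  intro N δ hN hδ hδc hδN r₁ r₂ V D hV hD
  have hN0 : 0 < N := by linarith
  set η := √δ with hη
  have hη0 : 0 < η := Real.sqrt_pos.2 hδ
  have hηc : η ≤ c := by
    rw [hη]; exact Real.sqrt_le_iff.2 ⟨hc.le, hδc⟩
  have hηδ : η ^ 2 = δ := Real.sq_sqrt hδ.le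
  have hδ1 : δ ≤ 1 := hδc.trans (by nlinarith)
  set r₃ : ℝ := (r₁ ^ α + r₂ ^ α - 1) ^ α⁻¹ with hr₃
  have tan : ∀ n ∈ V, _ := fun n hn =>
    have h := (hV n hn).1
    have up : ∀ x ∈ Set.Icc (1 / κ ^ 2) (κ ^ 2), x ∈ Set.Icc (1 / K₀) K₀ := fun x hx =>
      Icc_inv_subset (by nlinarith) (by linarith) hx
    tangent η hη0 hηc _ (up _ (mem_Icc_div_of_mem_Icc hκ hN0 h.1 h.2.2.2.1))
      _ (up _ (mem_Icc_div_of_mem_Icc hκ hN0 h.2.1 h.2.2.2.1))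
      _ (up _ (mem_Icc_div_of_mem_Icc hκ hN0 h.2.2.1 h.2.2.2.1)) r₁ r₂ (hV n hn).2.1 (hV n hn).2.2
      ((h.rescale hκ hN0 hδ.le).trans (by rw [hηδ]; gcongr; rw [hK₀]; linarith [sq_nonneg κ])) r₃ hr₃
  rcases V.eq_empty_or_nonempty with rfl | ⟨n₀, hn₀⟩
  · simp only [Finset.card_empty, Nat.cast_zero]; positivity
  obtain ⟨R1, R2, R3, cone, -⟩ := tan n₀ hn₀
  set a₁ := (r₁ / r₃) ^ (α - 1) with ha₁
  set a₂ := (r₂ / r₃) ^ (α - 1) with ha₂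
  set a₄ := (1 / r₃) ^ (α - 1) with ha₄
  classical
  set f : ℤ × ℤ × ℤ × ℤ → ℤ × ℤ × ℤ × ℤ := fun m => (m.1, m.2.1, -m.2.2.1, -m.2.2.2) with hf
  set g : ℤ × ℤ × ℤ × ℤ → ℤ × ℤ × ℤ × ℤ := fun m => (-m.1, -m.2.1, m.2.2.1, m.2.2.2) with hg
  set W : Finset (ℤ × ℤ × ℤ × ℤ) := insert 0 (D.image f ∪ D.image g) with hW
  have hWcard : (W.card : ℝ) ≤ 1 + 2 * D.card := by
    have h1 : W.card ≤ (D.image f ∪ D.image g).card + 1 := Finset.card_insert_le _ _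
    have h2 := Finset.card_union_le (D.image f) (D.image g)
    have h3 : (D.image f).card ≤ D.card := Finset.card_image_le
    have h4 : (D.image g).card ≤ D.card := Finset.card_image_le
    have : W.card ≤ 1 + 2 * D.card := by omega
    exact_mod_cast this
  have key := card_le_mul_card_dual a₁ a₂ (-a₄) r₁ r₂ (B * N) (B * (η * N)) (B * (δ * N))
    (by positivity) (by positivity) (by positivity) V W ?_ ?_
  · refine key.trans ?_
    have e : 4 * 48 ^ 4 * (B * N * (B * (η * N)) ^ 2 * (B * (δ * N))) =
        4 * 48 ^ 4 * B ^ 4 * (N ^ 4 * δ ^ 2) := by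
      rw [← hηδ]; ring
    rw [e]
    exact mul_le_mul_of_nonneg_left hWcard (by positivity)
  · intro n hn
    obtain ⟨-, -, -, -, plane⟩ := tan n hn
    obtain ⟨near, c1, c2⟩ := hV n hn
    have h4 := near.2.2.2.1
    have p4 : 0 < (n.2.2.2 : ℝ) := lt_of_lt_of_le (by positivity) h4.1
    have b4 : (n.2.2.2 : ℝ) ≤ B * N := h4.2.trans (by gcongr)
    have mulc : ∀ x r : ℝ, |x / n.2.2.2 - r| ≤ η → |x - r * n.2.2.2| ≤ B * (η * N) := by
      intro x r h
      have : x - r * n.2.2.2 = (x / n.2.2.2 - r) * n.2.2.2 := by field_simp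
      rw [this, abs_mul, abs_of_pos p4]
      calc _ ≤ η * (B * N) := by gcongr
        _ = _ := by ring
    refine ⟨by rwa [abs_of_pos p4], mulc _ _ c1, mulc _ _ c2, ?_⟩
    have e : (n.2.2.1 : ℝ) - a₁ * n.1 - a₂ * n.2.1 - (-a₄) * n.2.2.2 =
        -((a₁ * (n.1 / n.2.2.2) + a₂ * (n.2.1 / n.2.2.2) - a₄ - n.2.2.1 / n.2.2.2) * n.2.2.2) := by
      field_simp
      ring
    rw [e, abs_neg, abs_mul, abs_of_pos p4]
    calc _ ≤ T * η ^ 2 * (κ * N) := mul_le_mul plane h4.2 p4.le (by positivity)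
      _ = κ * T * (δ * N) := by rw [hηδ]; ring
      _ ≤ _ := by gcongr
  · have main : ∀ m₁ m₂ m₃ m₄ : ℤ, 0 ≤ m₃ → (m₃ : ℝ) ≤ 1 / 24 / (B * (δ * N)) →
        |(m₁ : ℝ) - a₁ * m₃| ≤ 1 / 24 / (B * (η * N)) →
        |(m₂ : ℝ) - a₂ * m₃| ≤ 1 / 24 / (B * (η * N)) →
        |(m₄ : ℝ) - a₄ * m₃ - r₁ * (m₁ - a₁ * m₃) - r₂ * (m₂ - a₂ * m₃)| ≤ 1 / 24 / (B * N) →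
        (m₁ = 0 ∧ m₂ = 0 ∧ m₃ = 0 ∧ m₄ = 0) ∨ (m₁, m₂, m₃, m₄) ∈ D := by
      intro m₁ m₂ m₃ m₄ h0 h3 h1 h2 h4
      rcases polar N δ hN hδ hδ1 hδN r₁ R1 r₂ R2 r₃ R3 cone m₁ m₂ m₃ m₄ h0 h3 h1 h2 h4 with h | h
      · exact Or.inl h
      · exact Or.inr (hD _ ⟨h.1, h.2.1, h.2.2.1⟩ h.2.2.2.1 h.2.2.2.2)
    rintro ⟨w₁, w₂, w₃, w₄⟩ h3 h1 h2 h4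
    simp only at h3 h1 h2 h4
    rw [hW, Finset.mem_insert, Finset.mem_union, Finset.mem_image, Finset.mem_image]
    rcases le_total 0 w₃ with h | h
    · have s1 : |((-w₁ : ℤ) : ℝ) - a₁ * w₃| ≤ 1 / 24 / (B * (η * N)) := by
        rw [← abs_neg]; refine le_of_eq_of_le ?_ h1; congr 1; push_cast; ring
      have s2 : |((-w₂ : ℤ) : ℝ) - a₂ * w₃| ≤ 1 / 24 / (B * (η * N)) := by
        rw [← abs_neg]; refine le_of_eq_of_le ?_ h2; congr 1; push_cast; ring
      rcases main (-w₁) (-w₂) w₃ w₄ h ((le_abs_self _).trans h3) s1 s2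
        (by refine le_of_eq_of_le ?_ h4; congr 1; push_cast; ring) with h | h
      · left
        obtain ⟨e1, e2, e3, e4⟩ := h
        simp only [Prod.ext_iff, Prod.fst_zero, Prod.snd_zero]
        omega
      · right; right
        exact ⟨_, h, by simp [hg]⟩
    · have s1 : |(w₁ : ℝ) - a₁ * (-w₃ : ℤ)| ≤ 1 / 24 / (B * (η * N)) := by
        refine le_of_eq_of_le ?_ h1; congr 1; push_cast; ring
      have s2 : |(w₂ : ℝ) - a₂ * (-w₃ : ℤ)| ≤ 1 / 24 / (B * (η * N)) := by
        refine le_of_eq_of_le ?_ h2; congr 1; push_cast; ring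
      rcases main w₁ w₂ (-w₃) (-w₄) (by omega) (by push_cast; exact (neg_le_abs _).trans h3) s1 s2
        (by rw [← abs_neg]; refine le_of_eq_of_le ?_ h4; congr 1; push_cast; ring) with h | h
      · left
        obtain ⟨e1, e2, e3, e4⟩ := h
        simp only [Prod.ext_iff, Prod.fst_zero, Prod.snd_zero]
        omega
      · right; left
        exact ⟨_, h, by simp [hf]⟩

/-- The additive energy bound with exponent `τ` for points close to the cone with exponent `γ`. -/
def HasEnergyBound (γ τ : ℝ) : Prop :=
  ∀ κ : ℝ, 1 ≤ κ → ∃ C : ℝ, 0 < C ∧ ∀ N δ : ℝ, 1 ≤ N → 0 < δ →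
    ∀ S : Finset (ℤ × ℤ × ℤ × ℤ), (∀ n ∈ S, IsNearCone γ κ N δ n) →
      (S.card : ℝ) ≤ C * (δ * N ^ 4 + N ^ τ)

theorem card_le_of_abs_sub_le {η T ρ : ℝ} (hη : 0 < η) (hT : 0 ≤ T) (F : Finset ℤ)
    (hF : ∀ i ∈ F, |η * i - ρ| ≤ T) : (F.card : ℝ) ≤ 2 * T / η + 1 := by
  have hsub : F ⊆ Finset.Icc ⌈(ρ - T) / η⌉ ⌊(ρ + T) / η⌋ := by
    intro i hi
    have h := abs_le.1 (hF i hi)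
    rw [Finset.mem_Icc, Int.ceil_le, Int.le_floor, div_le_iff₀ hη, le_div_iff₀ hη]
    constructor <;> linarith [h.1, h.2]
  have hc := Finset.card_le_card hsub
  rw [Int.card_Icc] at hc
  have hc' : (F.card : ℝ) ≤ ((⌊(ρ + T) / η⌋ + 1 - ⌈(ρ - T) / η⌉).toNat : ℝ) := by exact_mod_cast hc
  refine hc'.trans ?_
  have e : 2 * T / η + 1 = (ρ + T) / η + 1 - (ρ - T) / η := by field_simp; ring
  have h1 := Int.floor_le ((ρ + T) / η)
  have h2 := Int.le_ceil ((ρ - T) / η)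
  rcases le_total 0 (⌊(ρ + T) / η⌋ + 1 - ⌈(ρ - T) / η⌉) with h | h
  · have : ((⌊(ρ + T) / η⌋ + 1 - ⌈(ρ - T) / η⌉).toNat : ℝ) =
        ((⌊(ρ + T) / η⌋ + 1 - ⌈(ρ - T) / η⌉ : ℤ) : ℝ) := by
      exact_mod_cast congrArg (Int.cast : ℤ → ℝ) (Int.toNat_of_nonneg h)
    rw [this, e]
    push_cast
    linarith
  · rw [Int.toNat_of_nonpos h]
    simp only [Nat.cast_zero]
    positivity

theorem IsDualPoint.isNearCone {β K N δ M : ℝ} (hK : 1 ≤ K) (hN : 1 ≤ N) (hδ : 0 < δ) (hM : 0 < M)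
    {m : ℤ × ℤ × ℤ × ℤ} (hm : IsDualPoint β K N δ m) (h1 : M ≤ m.2.2.1) (h2 : (m.2.2.1 : ℝ) ≤ 2 * M) :
    IsNearCone β (2 * K) M (2 ^ |β| * K / (δ * N ^ 2 * M ^ 2)) m := by
  obtain ⟨-, -, g1, g2, g3, g4, g⟩ := hm
  have hN0 : 0 < N := by linarith
  have up : ∀ z : ℝ, z ∈ Set.Icc ((m.2.2.1 : ℝ) / K) (K * m.2.2.1) →
      z ∈ Set.Icc (M / (2 * K)) (2 * K * M) := by
    intro z hz
    constructor
    · refine le_trans ?_ hz.1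
      gcongr <;> linarith
    · refine hz.2.trans ?_
      nlinarith
  refine ⟨up _ g1, up _ g2, up _ g3, up _ g4, g.trans ?_⟩
  set x : ℝ := (m.2.2.1 : ℝ) with hx
  have hx0 : 0 < x := by linarith
  have hr : x / M ∈ Set.Icc (1 / 2 : ℝ) 2 := by
    constructor
    · rw [le_div_iff₀ hM]; linarith
    · rw [div_le_iff₀ hM]; linarith
  have hp := (rpow_mem_Icc β 2 (by norm_num) hr).2
  have hMβ := Real.rpow_pos_of_pos hM β
  rw [Real.div_rpow hx0.le hM.le, div_le_iff₀ hMβ] at hp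
  calc K / (δ * N ^ 2 * x ^ 2) * x ^ β ≤ K / (δ * N ^ 2 * M ^ 2) * (2 ^ |β| * M ^ β) := by gcongr
    _ = _ := by ring

theorem exists_sum_inv_sq_le (β K σ : ℝ) (hK : 1 ≤ K) (hσ : 0 < σ) (h : HasEnergyBound β (2 + σ)) :
    ∃ C : ℝ, 0 < C ∧ ∀ N δ : ℝ, 1 ≤ N → 0 < δ → 1 ≤ δ * N ^ 2 → ∀ D : Finset (ℤ × ℤ × ℤ × ℤ),
      (∀ m ∈ D, IsDualPoint β K N δ m) →
      ∑ m ∈ D, 1 / (m.2.2.1 : ℝ) ^ 2 ≤ C * (δ * N) ^ (-σ) := by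
  obtain ⟨C, hC, hb⟩ := h (2 * K) (by linarith)
  set E : ℝ := 2 ^ |β| * K with hE
  have hK0 : 0 < K := by linarith
  have hE0 : 0 < E := by positivity
  set q : ℝ := 2 ^ σ with hq
  have hq1 : 1 < q := Real.one_lt_rpow (by norm_num) hσ
  have hq0 : 0 < q := by linarith
  have hq1' : 0 < q - 1 := by linarith
  refine ⟨C * (E + 1) * (q * K ^ σ / (q - 1)), by positivity, ?_⟩
  intro N δ hN hδ hδN D hD
  have hN0 : 0 < N := by linarith
  set J : ℝ := K / (δ * N) with hJ
  have hJ0 : 0 < J := by positivity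
  have hJσ : J ^ σ = K ^ σ * (δ * N) ^ (-σ) := by
    rw [hJ, Real.div_rpow hK0.le (by positivity), Real.rpow_neg (by positivity), div_eq_mul_inv]
  rcases D.eq_empty_or_nonempty with rfl | ⟨m₀, hm₀⟩
  · simp only [Finset.sum_empty]; positivity
  have hJ1 : 1 ≤ J := by
    have h1 : (1 : ℝ) ≤ (m₀.2.2.1 : ℝ) := by exact_mod_cast (hD _ hm₀).1
    exact h1.trans (hD _ hm₀).2.1
  set ℓ : ℤ × ℤ × ℤ × ℤ → ℕ := fun m => Nat.log 2 m.2.2.1.toNat with hℓ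
  set Λ : ℕ := Nat.log 2 ⌊J⌋₊ with hΛ
  have toNat_cast : ∀ m ∈ D, ((m.2.2.1.toNat : ℕ) : ℝ) = (m.2.2.1 : ℝ) := by
    intro m hm
    have h1 := (hD m hm).1
    exact_mod_cast congrArg (Int.cast : ℤ → ℝ) (Int.toNat_of_nonneg (by omega : 0 ≤ m.2.2.1))
  have low : ∀ m ∈ D, (2 : ℝ) ^ ℓ m ≤ (m.2.2.1 : ℝ) := by
    intro m hm
    rw [← toNat_cast m hm]
    have h1 := (hD m hm).1
    exact_mod_cast Nat.pow_log_le_self 2 (by omega : m.2.2.1.toNat ≠ 0)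
  have high : ∀ m ∈ D, (m.2.2.1 : ℝ) ≤ 2 * 2 ^ ℓ m := by
    intro m hm
    rw [← toNat_cast m hm, ← pow_succ']
    exact_mod_cast (Nat.lt_pow_succ_log_self (by norm_num : 1 < 2) m.2.2.1.toNat).le
  have maps : ∀ m ∈ D, ℓ m ∈ Finset.range (Λ + 1) := by
    intro m hm
    rw [Finset.mem_range, Nat.lt_succ_iff]
    refine Nat.log_mono_right (Nat.le_floor ?_)
    rw [toNat_cast m hm]
    exact (hD m hm).2.1
  rw [← Finset.sum_fiberwise_of_maps_to maps]
  have block : ∀ j ∈ Finset.range (Λ + 1),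
      ∑ m ∈ D with ℓ m = j, 1 / (m.2.2.1 : ℝ) ^ 2 ≤ C * (E + 1) * q ^ j := by
    intro j _
    set M : ℝ := 2 ^ j with hM
    have hM0 : 0 < M := by positivity
    have hM1 : 1 ≤ M := one_le_pow₀ (by norm_num)
    have hMσ : M ^ σ = q ^ j := by
      rw [hM, hq, ← Real.rpow_natCast, ← Real.rpow_natCast, ← Real.rpow_mul (by norm_num),
        ← Real.rpow_mul (by norm_num), mul_comm]
    have hcard := hb M (E / (δ * N ^ 2 * M ^ 2)) hM1 (by positivity) (D.filter fun m => ℓ m = j) (by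
      intro m hm
      obtain ⟨hmD, hmj⟩ := Finset.mem_filter.1 hm
      have h1 := low m hmD
      have h2 := high m hmD
      rw [hmj] at h1 h2
      exact (hD m hmD).isNearCone hK hN hδ hM0 h1 h2)
    have e1 : E / (δ * N ^ 2 * M ^ 2) * M ^ 4 ≤ E * M ^ 2 * M ^ σ := by
      have e : E / (δ * N ^ 2 * M ^ 2) * M ^ 4 = E * M ^ 2 / (δ * N ^ 2) := by field_simp
      rw [e]
      have a1 : E * M ^ 2 / (δ * N ^ 2) ≤ E * M ^ 2 := div_le_self (by positivity) hδN
      exact a1.trans (le_mul_of_one_le_right (by positivity) (Real.one_le_rpow hM1 hσ.le))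
    have e2 : M ^ (2 + σ) = M ^ 2 * M ^ σ := by
      rw [Real.rpow_add hM0]; norm_num
    rw [e2] at hcard
    calc ∑ m ∈ D with ℓ m = j, 1 / (m.2.2.1 : ℝ) ^ 2
        ≤ ∑ m ∈ D with ℓ m = j, 1 / M ^ 2 := by
          refine Finset.sum_le_sum fun m hm => ?_
          obtain ⟨hmD, hmj⟩ := Finset.mem_filter.1 hm
          have h1 := low m hmD
          rw [hmj] at h1
          gcongr
      _ = ((D.filter fun m => ℓ m = j).card : ℝ) * (1 / M ^ 2) := by
          rw [Finset.sum_const, nsmul_eq_mul]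
      _ ≤ C * (E * M ^ 2 * M ^ σ + M ^ 2 * M ^ σ) * (1 / M ^ 2) := by
          gcongr
          refine hcard.trans ?_
          gcongr
      _ = C * (E + 1) * q ^ j := by rw [← hMσ]; field_simp
  refine (Finset.sum_le_sum block).trans ?_
  rw [← Finset.mul_sum, geom_sum_eq hq1.ne', mul_assoc _ (q * K ^ σ / (q - 1))]
  refine mul_le_mul_of_nonneg_left ?_ (by positivity)
  have hΛJ : q ^ Λ ≤ J ^ σ := by
    have a : (2 : ℝ) ^ Λ ≤ J := by
      have h1 : (2 ^ Λ : ℕ) ≤ ⌊J⌋₊ := Nat.pow_log_le_self 2 (Nat.floor_pos.2 hJ1).ne'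
      exact (by exact_mod_cast h1 : (2 : ℝ) ^ Λ ≤ (⌊J⌋₊ : ℝ)).trans (Nat.floor_le hJ0.le)
    have b : q ^ Λ = ((2 : ℝ) ^ Λ) ^ σ := by
      rw [hq, ← Real.rpow_natCast, ← Real.rpow_natCast, ← Real.rpow_mul (by norm_num),
        ← Real.rpow_mul (by norm_num), mul_comm]
    rw [b]
    exact Real.rpow_le_rpow (by positivity) a hσ.le
  calc (q ^ (Λ + 1) - 1) / (q - 1) ≤ q * J ^ σ / (q - 1) := by
        gcongr
        rw [pow_succ']
        nlinarith
    _ = _ := by rw [hJσ]; ring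

theorem card_Icc_one_floor_le {x : ℝ} (hx : 0 ≤ x) : ((Finset.Icc 1 ⌊x⌋).card : ℝ) ≤ x := by
  rw [Int.card_Icc, add_sub_cancel_right]
  have : ((⌊x⌋.toNat : ℕ) : ℝ) = ((⌊x⌋ : ℤ) : ℝ) := by
    exact_mod_cast congrArg (Int.cast : ℤ → ℝ) (Int.toNat_of_nonneg (Int.floor_nonneg.2 hx))
  rw [this]
  exact Int.floor_le _

theorem mem_Icc_one_floor {κ N : ℝ} (hκ : 1 ≤ κ) (hN : 1 ≤ N) {z : ℤ}
    (hz : (z : ℝ) ∈ Set.Icc (N / κ) (κ * N)) : z ∈ Finset.Icc 1 ⌊κ * N⌋ := by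
  have h0 : 0 < (z : ℝ) := lt_of_lt_of_le (by positivity) hz.1
  rw [Finset.mem_Icc, Int.le_floor]
  exact ⟨by exact_mod_cast h0, hz.2⟩

theorem exists_card_box_le (κ : ℝ) (hκ : 1 ≤ κ) {γ N δ : ℝ} (hN : 1 ≤ N)
    (S : Finset (ℤ × ℤ × ℤ × ℤ)) (hS : ∀ n ∈ S, IsNearCone γ κ N δ n) :
    (S.card : ℝ) ≤ (κ * N) ^ 4 := by
  have hκN : 0 < κ * N := by nlinarith
  set I : Finset ℤ := Finset.Icc 1 ⌊κ * N⌋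
  have hmem : ∀ z : ℤ, (z : ℝ) ∈ Set.Icc (N / κ) (κ * N) → z ∈ I := fun z hz =>
    mem_Icc_one_floor hκ hN hz
  have hsub : S ⊆ I ×ˢ I ×ˢ I ×ˢ I := by
    intro n hn
    obtain ⟨h1, h2, h3, h4, -⟩ := hS n hn
    simp only [Finset.mem_product]
    exact ⟨hmem _ h1, hmem _ h2, hmem _ h3, hmem _ h4⟩
  have hc := Finset.card_le_card hsub
  have hIc : (I.card : ℝ) ≤ κ * N := card_Icc_one_floor_le hκN.le
  calc (S.card : ℝ) ≤ ((I ×ˢ I ×ˢ I ×ˢ I).card : ℝ) := by exact_mod_cast hc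
    _ = (I.card : ℝ) ^ 4 := by
      simp only [Finset.card_product]; push_cast; ring
    _ ≤ _ := by gcongr

theorem finite_setOf_isDualPoint (β K N δ : ℝ) (hK : 1 ≤ K) :
    {m | IsDualPoint β K N δ m}.Finite := by
  set I : Finset ℤ := Finset.Icc 0 ⌊K * (K / (δ * N))⌋ with hI
  refine (I ×ˢ I ×ˢ I ×ˢ I).finite_toSet.subset ?_
  rintro m ⟨h1, h2, g1, g2, g3, g4, -⟩
  have hm1 : (1 : ℝ) ≤ (m.2.2.1 : ℝ) := by exact_mod_cast h1
  have hmem : ∀ z : ℤ, (z : ℝ) ∈ Set.Icc ((m.2.2.1 : ℝ) / K) (K * m.2.2.1) → z ∈ I := by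
    intro z hz
    have h0 : 0 ≤ (z : ℝ) := le_trans (by positivity) hz.1
    rw [hI, Finset.mem_Icc, Int.le_floor]
    exact ⟨by exact_mod_cast h0, hz.2.trans (by gcongr)⟩
  simp only [Finset.coe_product, Set.mem_prod, Finset.mem_coe]
  exact ⟨hmem _ g1, hmem _ g2, hmem _ g3, hmem _ g4⟩

set_option maxHeartbeats 1000000 in
/-- An energy bound for the conjugate exponent gives one for `α`. -/
theorem HasEnergyBound.exists_card_le (α β κ σ : ℝ) (hα : α ≠ 0) (hα1 : α ≠ 1)
    (hβ : β = α / (α - 1)) (hκ : 1 ≤ κ) (hσ : 0 < σ) (h : HasEnergyBound β (2 + σ)) :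
    ∃ C : ℝ, 0 < C ∧ ∀ N δ : ℝ, 1 ≤ N → 0 < δ → 1 ≤ δ * N ^ 2 →
      ∀ S : Finset (ℤ × ℤ × ℤ × ℤ), (∀ n ∈ S, IsNearCone α κ N δ n) →
        (S.card : ℝ) ≤ C * (δ * N ^ 4 + N ^ 2 * (δ * N) ^ (-σ)) := by
  classical
  have hκ0 : 0 < κ := by linarith
  obtain ⟨K, C₁, c, hK, hC₁, hc, hc1, cell⟩ := exists_card_cell_le α β κ hα hα1 hβ hκ
  have hK0 : 0 < K := by linarith
  obtain ⟨C₂, hC₂, dyadic⟩ := exists_sum_inv_sq_le β K σ hK hσ h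
  refine ⟨κ ^ 4 / c + 4 * C₁ * κ ^ 4 + 18 * C₁ * K ^ 2 * C₂, by positivity, ?_⟩
  intro N δ hN hδ hδN S hS
  have hN0 : 0 < N := by linarith
  have hX : 0 < N ^ 2 * (δ * N) ^ (-σ) := by positivity
  set X := N ^ 2 * (δ * N) ^ (-σ) with hXdef
  rcases lt_or_ge c δ with hcδ | hδc
  · refine (exists_card_box_le κ hκ hN S hS).trans ?_
    calc (κ * N) ^ 4 = κ ^ 4 / c * (c * N ^ 4) := by field_simp
      _ ≤ κ ^ 4 / c * (δ * N ^ 4) := by gcongr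
      _ ≤ (κ ^ 4 / c + 4 * C₁ * κ ^ 4 + 18 * C₁ * K ^ 2 * C₂) * (δ * N ^ 4 + X) := by
        gcongr
        · have : 0 ≤ 4 * C₁ * κ ^ 4 + 18 * C₁ * K ^ 2 * C₂ := by positivity
          linarith
        · linarith
  set η := √δ with hη
  have hη0 : 0 < η := Real.sqrt_pos.2 hδ
  have hηδ : η ^ 2 = δ := Real.sq_sqrt hδ.le
  have hη1 : η ≤ 1 := Real.sqrt_le_one.2 (hδc.trans hc1)
  have hηN : 1 ≤ η * N := by
    have : 1 ≤ (η * N) ^ 2 := by rw [mul_pow, hηδ]; exact hδN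
    exact (one_le_sq_iff₀ (by positivity)).1 this
  set D : Finset (ℤ × ℤ × ℤ × ℤ) := (finite_setOf_isDualPoint β K N δ hK).toFinset with hD
  have memD : ∀ m, m ∈ D ↔ IsDualPoint β K N δ m := fun m =>
    Set.Finite.mem_toFinset _
  have hsum := dyadic N δ hN hδ hδN D (fun m hm => (memD m).1 hm)
  set I : Finset ℤ := Finset.Icc 0 ⌊κ ^ 2 / η⌋ with hI
  have hy : 1 ≤ κ ^ 2 / η := by
    rw [le_div_iff₀ hη0]
    nlinarith
  have hIcard : (I.card : ℝ) ≤ 2 * (κ ^ 2 / η) := by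
    rw [hI, Int.card_Icc, sub_zero]
    have hfl : (0 : ℤ) ≤ ⌊κ ^ 2 / η⌋ := Int.floor_nonneg.2 (by linarith)
    have : (((⌊κ ^ 2 / η⌋ + 1).toNat : ℕ) : ℝ) = ((⌊κ ^ 2 / η⌋ + 1 : ℤ) : ℝ) := by
      exact_mod_cast congrArg (Int.cast : ℤ → ℝ) (Int.toNat_of_nonneg (by omega))
    rw [this]
    push_cast
    linarith [Int.floor_le (κ ^ 2 / η)]
  set R : Finset (ℤ × ℤ) := I ×ˢ I with hR
  have hRcard : (R.card : ℝ) ≤ 4 * κ ^ 4 / δ := by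
    rw [hR, Finset.card_product]
    push_cast
    calc (I.card : ℝ) * I.card ≤ (2 * (κ ^ 2 / η)) * (2 * (κ ^ 2 / η)) := by gcongr
      _ = _ := by rw [← hηδ]; field_simp; norm_num
  set idx : ℤ × ℤ × ℤ × ℤ → ℤ × ℤ := fun n =>
    (⌊(n.1 : ℝ) / n.2.2.2 / η⌋, ⌊(n.2.1 : ℝ) / n.2.2.2 / η⌋) with hidx
  have hmaps : ∀ n ∈ S, idx n ∈ R := by
    intro n hn
    obtain ⟨h1, h2, h3, h4, -⟩ := hS n hn
    have mem : ∀ x : ℝ, x ∈ Set.Icc (1 / κ ^ 2) (κ ^ 2) → ⌊x / η⌋ ∈ I := by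
      intro x hx
      have hx0 : 0 < x := lt_of_lt_of_le (by positivity) hx.1
      rw [hI, Finset.mem_Icc]
      refine ⟨Int.floor_nonneg.2 (by positivity), Int.floor_le_floor ?_⟩
      gcongr
      exact hx.2
    rw [hR, Finset.mem_product]
    exact ⟨mem _ (mem_Icc_div_of_mem_Icc hκ hN0 h1 h4), mem _ (mem_Icc_div_of_mem_Icc hκ hN0 h2 h4)⟩
  set rel : ℤ × ℤ → ℤ × ℤ × ℤ × ℤ → Prop := fun i m =>
    |η * i.1 - ((m.1 : ℝ) / m.2.2.2) ^ (α - 1)⁻¹| ≤ K / (η * N * m.2.2.1) ∧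
      |η * i.2 - ((m.2.1 : ℝ) / m.2.2.2) ^ (α - 1)⁻¹| ≤ K / (η * N * m.2.2.1) with hrel
  have hfib : ∀ i ∈ R, ((S.filter fun n => idx n = i).card : ℝ) ≤
      C₁ * (N ^ 4 * δ ^ 2) * (1 + 2 * ((D.bipartiteAbove rel i).card : ℝ)) := by
    intro i _
    refine cell N δ hN hδ hδc hηN (η * i.1) (η * i.2) _ _ ?_ ?_
    · intro n hn
      obtain ⟨hnS, hni⟩ := Finset.mem_filter.1 hn
      have close : ∀ x : ℝ, |x - η * ⌊x / η⌋| ≤ η := by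
        intro x
        have e : x - η * ⌊x / η⌋ = η * (x / η - ⌊x / η⌋) := by field_simp
        rw [e, abs_mul, abs_of_pos hη0, abs_of_nonneg (by linarith [Int.floor_le (x / η)])]
        nlinarith [Int.lt_floor_add_one (x / η)]
      rw [← hni]
      exact ⟨hS n hnS, close _, close _⟩
    · intro m hm h1 h2
      rw [Finset.mem_bipartiteAbove]
      exact ⟨(memD m).2 hm, h1, h2⟩
  have hbelow : ∀ m ∈ D, ((R.bipartiteBelow rel m).card : ℝ) ≤
      9 * K ^ 2 / (δ * N) ^ 2 * (1 / (m.2.2.1 : ℝ) ^ 2) := by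
    intro m hm
    obtain ⟨hm1, hm2, -⟩ := (memD m).1 hm
    have hm1' : (1 : ℝ) ≤ (m.2.2.1 : ℝ) := by exact_mod_cast hm1
    have hm0 : (0 : ℝ) < (m.2.2.1 : ℝ) := by linarith
    set T : ℝ := K / (η * N * m.2.2.1) with hT
    have hTη : T / η = K / (δ * N * m.2.2.1) := by rw [hT, ← hηδ]; field_simp
    have hTη1 : 1 ≤ T / η := by
      rw [hTη, le_div_iff₀ (by positivity)]
      rw [le_div_iff₀ (by positivity)] at hm2
      linarith
    have count : ∀ ρ : ℝ, ((I.filter fun i : ℤ => |η * i - ρ| ≤ T).card : ℝ) ≤ 3 * (T / η) := by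
      intro ρ
      have := card_le_of_abs_sub_le (ρ := ρ) hη0 (by positivity : 0 ≤ T)
        (I.filter fun i : ℤ => |η * i - ρ| ≤ T) (fun i hi => (Finset.mem_filter.1 hi).2)
      rw [mul_div_assoc] at this
      linarith
    set ρ₁ := ((m.1 : ℝ) / m.2.2.2) ^ (α - 1)⁻¹
    set ρ₂ := ((m.2.1 : ℝ) / m.2.2.2) ^ (α - 1)⁻¹
    have hsub : R.bipartiteBelow rel m ⊆ (I.filter fun i : ℤ => |η * i - ρ₁| ≤ T) ×ˢ
        (I.filter fun i : ℤ => |η * i - ρ₂| ≤ T) := by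
      intro i hi
      rw [Finset.mem_bipartiteBelow, hR, Finset.mem_product] at hi
      rw [Finset.mem_product, Finset.mem_filter, Finset.mem_filter]
      exact ⟨⟨hi.1.1, hi.2.1⟩, hi.1.2, hi.2.2⟩
    have hcard := Finset.card_le_card hsub
    rw [Finset.card_product] at hcard
    calc ((R.bipartiteBelow rel m).card : ℝ)
        ≤ ((I.filter fun i : ℤ => |η * i - ρ₁| ≤ T).card : ℝ) *
          ((I.filter fun i : ℤ => |η * i - ρ₂| ≤ T).card : ℝ) := by exact_mod_cast hcard
      _ ≤ 3 * (T / η) * (3 * (T / η)) := by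
        gcongr
        · exact count _
        · exact count _
      _ = _ := by rw [hTη]; field_simp; norm_num
  have hdouble : ∑ i ∈ R, ((D.bipartiteAbove rel i).card : ℝ) ≤
      9 * K ^ 2 / (δ * N) ^ 2 * (C₂ * (δ * N) ^ (-σ)) := by
    have e : ∑ i ∈ R, ((D.bipartiteAbove rel i).card : ℝ) =
        ∑ m ∈ D, ((R.bipartiteBelow rel m).card : ℝ) := by
      exact_mod_cast Finset.sum_card_bipartiteAbove_eq_sum_card_bipartiteBelow rel
    rw [e]
    refine (Finset.sum_le_sum hbelow).trans ?_
    rw [← Finset.mul_sum]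
    gcongr
  have hScard : (S.card : ℝ) = ∑ i ∈ R, ((S.filter fun n => idx n = i).card : ℝ) := by
    exact_mod_cast Finset.card_eq_sum_card_fiberwise hmaps
  rw [hScard]
  calc ∑ i ∈ R, ((S.filter fun n => idx n = i).card : ℝ)
      ≤ ∑ i ∈ R, C₁ * (N ^ 4 * δ ^ 2) * (1 + 2 * ((D.bipartiteAbove rel i).card : ℝ)) :=
        Finset.sum_le_sum hfib
    _ = C₁ * (N ^ 4 * δ ^ 2) * (R.card + 2 * ∑ i ∈ R, ((D.bipartiteAbove rel i).card : ℝ)) := by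
      rw [← Finset.mul_sum, Finset.sum_add_distrib, ← Finset.mul_sum, Finset.sum_const,
        nsmul_eq_mul, mul_one]
    _ ≤ C₁ * (N ^ 4 * δ ^ 2) * (4 * κ ^ 4 / δ +
        2 * (9 * K ^ 2 / (δ * N) ^ 2 * (C₂ * (δ * N) ^ (-σ)))) := by gcongr
    _ = 4 * C₁ * κ ^ 4 * (δ * N ^ 4) + 18 * C₁ * K ^ 2 * C₂ * X := by
      rw [hXdef]; field_simp; ring
    _ ≤ _ := by
      have p1 : 0 ≤ κ ^ 4 / c := by positivity
      have p2 : 0 ≤ 4 * C₁ * κ ^ 4 := by positivity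
      have p3 : 0 ≤ 18 * C₁ * K ^ 2 * C₂ := by positivity
      have p4 : 0 ≤ δ * N ^ 4 := by positivity
      nlinarith [mul_nonneg p1 p4, mul_nonneg p1 hX.le, mul_nonneg p2 hX.le, mul_nonneg p3 p4]

theorem hasEnergyBound_three (α : ℝ) (hα : α ≠ 0) : HasEnergyBound α 3 := by
  classical
  intro κ hκ
  have hκ0 : 0 < κ := by linarith
  obtain ⟨C, hC, anti⟩ := exists_antilipschitz_rpow α κ hα hκ
  refine ⟨κ ^ 3 * (4 * C + 1), by positivity, ?_⟩
  intro N δ hN hδ S hS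
  have hN0 : 0 < N := by linarith
  set I : Finset ℤ := Finset.Icc 1 ⌊κ * N⌋
  have hIc : (I.card : ℝ) ≤ κ * N := card_Icc_one_floor_le (by positivity)
  set R : Finset (ℤ × ℤ × ℤ) := I ×ˢ I ×ˢ I with hR
  have hRcard : (R.card : ℝ) ≤ (κ * N) ^ 3 := by
    calc (R.card : ℝ) = (I.card : ℝ) ^ 3 := by
          simp only [hR, Finset.card_product]; push_cast; ring
      _ ≤ _ := by gcongr
  set p : ℤ × ℤ × ℤ × ℤ → ℤ × ℤ × ℤ := fun n => (n.1, n.2.1, n.2.2.1) with hp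
  have hmaps : ∀ n ∈ S, p n ∈ R := by
    intro n hn
    obtain ⟨h1, h2, h3, -⟩ := hS n hn
    simp only [hR, Finset.mem_product]
    exact ⟨mem_Icc_one_floor hκ hN h1, mem_Icc_one_floor hκ hN h2, mem_Icc_one_floor hκ hN h3⟩
  have scale : ∀ z : ℝ, z ∈ Set.Icc (N / κ) (κ * N) → 0 < z ∧ z / N ∈ Set.Icc (1 / κ) κ := by
    intro z hz
    refine ⟨lt_of_lt_of_le (by positivity) hz.1, ?_, ?_⟩
    · rw [le_div_iff₀ hN0, one_div_mul_eq_div]; exact hz.1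
    · rw [div_le_iff₀ hN0]; exact hz.2
  have hfib : ∀ t ∈ R, ((S.filter fun n => p n = t).card : ℝ) ≤ 4 * C * (δ * N) + 1 := by
    intro t _
    rcases (S.filter fun n => p n = t).eq_empty_or_nonempty with h | ⟨n₀, hn₀⟩
    · rw [h, Finset.card_empty, Nat.cast_zero]; positivity
    obtain ⟨hn₀S, hn₀t⟩ := Finset.mem_filter.1 hn₀
    have hinj : Set.InjOn (fun n : ℤ × ℤ × ℤ × ℤ => n.2.2.2)
        ((S.filter fun n => p n = t : Finset _) : Set (ℤ × ℤ × ℤ × ℤ)) := by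
      intro n hn n' hn' h
      have e := (Finset.mem_filter.1 hn).2.trans (Finset.mem_filter.1 hn').2.symm
      simp only [hp, Prod.ext_iff] at e h ⊢
      exact ⟨e.1, e.2.1, e.2.2, h⟩
    rw [← Finset.card_image_of_injOn hinj]
    have := card_le_of_abs_sub_le (ρ := (n₀.2.2.2 : ℝ)) one_pos
      (by positivity : 0 ≤ 2 * C * (δ * N)) ((S.filter fun n => p n = t).image fun n => n.2.2.2) ?_
    · rw [div_one] at this; linarith
    intro i hi
    obtain ⟨n, hn, rfl⟩ := Finset.mem_image.1 hi
    obtain ⟨hnS, hnt⟩ := Finset.mem_filter.1 hn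
    have e : p n = p n₀ := hnt.trans hn₀t.symm
    simp only [hp, Prod.ext_iff] at e
    obtain ⟨-, -, -, h4, h⟩ := hS n hnS
    obtain ⟨-, -, -, h4', h'⟩ := hS n₀ hn₀S
    rw [e.1, e.2.1, e.2.2] at h
    obtain ⟨p4, s4⟩ := scale _ h4
    obtain ⟨p4', s4'⟩ := scale _ h4'
    have a := anti _ s4 _ s4'
    have hNα := Real.rpow_pos_of_pos hN0 α
    have d : |(n.2.2.2 : ℝ) ^ α - (n₀.2.2.2 : ℝ) ^ α| ≤ 2 * δ * N ^ α := by
      rw [abs_le] at h h' ⊢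
      constructor <;> linarith [h.1, h.2, h'.1, h'.2]
    rw [Real.div_rpow p4.le hN0.le, Real.div_rpow p4'.le hN0.le, ← sub_div, ← sub_div, abs_div,
      abs_div, abs_of_pos hN0, abs_of_pos hNα, div_le_iff₀ hN0] at a
    rw [one_mul]
    calc _ ≤ _ := a
      _ ≤ C * (2 * δ * N ^ α / N ^ α) * N := by gcongr
      _ = _ := by field_simp
  have hScard : (S.card : ℝ) = ∑ t ∈ R, ((S.filter fun n => p n = t).card : ℝ) := by
    exact_mod_cast Finset.card_eq_sum_card_fiberwise hmaps
  have e3 : N ^ (3 : ℝ) = N ^ 3 := by norm_cast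
  rw [hScard, e3]
  calc _ ≤ ∑ t ∈ R, (4 * C * (δ * N) + 1) := Finset.sum_le_sum hfib
    _ = R.card * (4 * C * (δ * N) + 1) := by rw [Finset.sum_const, nsmul_eq_mul]
    _ ≤ (κ * N) ^ 3 * (4 * C * (δ * N) + 1) := by gcongr
    _ = κ ^ 3 * (4 * C * (δ * N ^ 4) + N ^ 3) := by ring
    _ ≤ κ ^ 3 * ((4 * C + 1) * (δ * N ^ 4 + N ^ 3)) := by
      have q1 : 0 ≤ δ * N ^ 4 := by positivity
      have q2 : 0 ≤ C * N ^ 3 := by positivity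
      gcongr
      linarith
    _ = _ := by ring

theorem HasEnergyBound.of_conj (α β σ : ℝ) (hα : α ≠ 0) (hα1 : α ≠ 1) (hβ : β = α / (α - 1))
    (hσ : 0 < σ) (h : HasEnergyBound β (2 + σ)) : HasEnergyBound α (2 + σ / (1 + σ)) := by
  intro κ hκ
  obtain ⟨C, hC, hb⟩ := h.exists_card_le α β κ σ hα hα1 hβ hκ hσ
  refine ⟨2 * C, by positivity, ?_⟩
  intro N δ hN hδ S hS
  have hN0 : 0 < N := by linarith
  set δ₀ : ℝ := N ^ (-(2 + σ) / (1 + σ)) with hδ₀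
  have hδ₀0 : 0 < δ₀ := Real.rpow_pos_of_pos hN0 _
  set δ₁ : ℝ := max δ δ₀ with hδ₁
  have hδ₁0 : 0 < δ₁ := lt_max_of_lt_left hδ
  have h0 : δ₀ ≤ δ₁ := le_max_right _ _
  have mulpow : ∀ k : ℕ, δ₀ * N ^ k = N ^ (-(2 + σ) / (1 + σ) + k) := by
    intro k
    rw [hδ₀, Real.rpow_add hN0, Real.rpow_natCast]
  have c1 : 1 ≤ δ₁ * N ^ 2 := by
    refine le_trans ?_ (mul_le_mul_of_nonneg_right h0 (by positivity))
    rw [mulpow]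
    refine Real.one_le_rpow hN ?_
    have : -(2 + σ) / (1 + σ) + ((2 : ℕ) : ℝ) = σ / (1 + σ) := by
      push_cast; field_simp; ring
    rw [this]
    positivity
  have c2 : δ₀ * N ^ 4 = N ^ (2 + σ / (1 + σ)) := by
    rw [mulpow]; congr 1; push_cast; field_simp; ring
  have c3 : N ^ 2 * (δ₁ * N) ^ (-σ) ≤ N ^ (2 + σ / (1 + σ)) := by
    have m : (δ₁ * N) ^ (-σ) ≤ (δ₀ * N) ^ (-σ) :=
      Real.rpow_le_rpow_of_nonpos (by positivity) (by gcongr) (by linarith)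
    have e : δ₀ * N = N ^ (-(2 + σ) / (1 + σ) + (1 : ℕ)) := by rw [← mulpow, pow_one]
    have e2 : N ^ 2 * (δ₀ * N) ^ (-σ) = N ^ (2 + σ / (1 + σ)) := by
      rw [e, ← Real.rpow_mul hN0.le, Real.rpow_add hN0, ← Real.rpow_natCast]
      congr 2
      push_cast; field_simp; ring
    rw [← e2]
    gcongr
  have key := hb N δ₁ hN hδ₁0 c1 S (fun n hn => by
    obtain ⟨h1, h2, h3, h4, hh⟩ := hS n hn
    refine ⟨h1, h2, h3, h4, hh.trans ?_⟩
    gcongr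
    exact le_max_left _ _)
  have c4 : δ₁ * N ^ 4 ≤ δ * N ^ 4 + N ^ (2 + σ / (1 + σ)) := by
    rw [← c2, ← add_mul]
    gcongr
    exact max_le (by linarith) (by linarith)
  have q : 0 ≤ δ * N ^ 4 := by positivity
  calc (S.card : ℝ) ≤ _ := key
    _ ≤ C * (2 * (δ * N ^ 4 + N ^ (2 + σ / (1 + σ)))) := by
      gcongr
      linarith
    _ = _ := by ring

theorem hasEnergyBound_two_add_one_div (n : ℕ) :
    ∀ α : ℝ, α ≠ 0 → α ≠ 1 → HasEnergyBound α (2 + 1 / ((n : ℝ) + 1)) := by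
  induction n with
  | zero =>
    intro α hα _
    have e : (2 : ℝ) + 1 / (((0 : ℕ) : ℝ) + 1) = 3 := by norm_num
    rw [e]
    exact hasEnergyBound_three α hα
  | succ n ih =>
    intro α hα hα1
    have h1 : α - 1 ≠ 0 := sub_ne_zero.2 hα1
    have hβ1 : α / (α - 1) ≠ 1 := by
      intro h
      rw [div_eq_one_iff_eq h1] at h
      linarith
    have := (ih _ (div_ne_zero hα h1) hβ1).of_conj α _ _ hα hα1 rfl (by positivity)
    convert this using 2
    push_cast
    field_simp

theorem stmt_12 (k : ℕ) (hk : 2 ≤ k) :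
    ∀ ε : ℝ, 0 < ε → ∃ C : ℝ, 0 < C ∧ ∀ δ : ℝ, 0 < δ → ∀ N : ℕ, 1 ≤ N →
      (Set.ncard {q : ℕ × ℕ × ℕ × ℕ |
          (N < q.1 ∧ q.1 ≤ 2 * N) ∧ (N < q.2.1 ∧ q.2.1 ≤ 2 * N) ∧
          (N < q.2.2.1 ∧ q.2.2.1 ≤ 2 * N) ∧ (N < q.2.2.2 ∧ q.2.2.2 ≤ 2 * N) ∧
          |(q.1 : ℝ) ^ ((1 : ℝ) / k) + (q.2.1 : ℝ) ^ ((1 : ℝ) / k) -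
            (q.2.2.1 : ℝ) ^ ((1 : ℝ) / k) - (q.2.2.2 : ℝ) ^ ((1 : ℝ) / k)| <
              δ * (N : ℝ) ^ ((1 : ℝ) / k)} : ℝ) ≤
        C * (N : ℝ) ^ ε * ((N : ℝ) ^ 4 * δ + (N : ℝ) ^ 2) := by
  intro ε hε
  have hk' : (2 : ℝ) ≤ k := by exact_mod_cast hk
  have hα : (1 : ℝ) / k ≠ 0 := by positivity
  have hα1 : (1 : ℝ) / k ≠ 1 := by
    rw [Ne, div_eq_one_iff_eq (by positivity)]
    linarith
  obtain ⟨n, hn⟩ := exists_nat_one_div_lt hε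
  obtain ⟨C, hC, hb⟩ := hasEnergyBound_two_add_one_div n _ hα hα1 2 (by norm_num)
  refine ⟨C, hC, ?_⟩
  intro δ hδ N hN
  have hN' : (1 : ℝ) ≤ N := by exact_mod_cast hN
  have hN0 : (0 : ℝ) < N := by linarith
  set A : Set (ℕ × ℕ × ℕ × ℕ) := {q : ℕ × ℕ × ℕ × ℕ |
          (N < q.1 ∧ q.1 ≤ 2 * N) ∧ (N < q.2.1 ∧ q.2.1 ≤ 2 * N) ∧
          (N < q.2.2.1 ∧ q.2.2.1 ≤ 2 * N) ∧ (N < q.2.2.2 ∧ q.2.2.2 ≤ 2 * N) ∧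
          |(q.1 : ℝ) ^ ((1 : ℝ) / k) + (q.2.1 : ℝ) ^ ((1 : ℝ) / k) -
            (q.2.2.1 : ℝ) ^ ((1 : ℝ) / k) - (q.2.2.2 : ℝ) ^ ((1 : ℝ) / k)| <
              δ * (N : ℝ) ^ ((1 : ℝ) / k)} with hA
  set I : Finset ℕ := Finset.Ioc N (2 * N)
  have hfin : A.Finite := by
    refine (I ×ˢ I ×ˢ I ×ˢ I).finite_toSet.subset ?_
    rintro q ⟨h1, h2, h3, h4, -⟩
    simp only [Finset.coe_product, Set.mem_prod, Finset.mem_coe]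
    exact ⟨Finset.mem_Ioc.2 h1, Finset.mem_Ioc.2 h2, Finset.mem_Ioc.2 h3, Finset.mem_Ioc.2 h4⟩
  classical
  set f : ℕ × ℕ × ℕ × ℕ → ℤ × ℤ × ℤ × ℤ := fun q => (q.1, q.2.1, q.2.2.1, q.2.2.2) with hf
  have hinj : Function.Injective f := by
    intro q q' h
    simp only [hf, Prod.ext_iff, Nat.cast_inj] at h ⊢
    exact h
  have key := hb N δ hN' hδ (hfin.toFinset.image f) (by
    intro m hm
    obtain ⟨q, hq, rfl⟩ := Finset.mem_image.1 hm
    obtain ⟨h1, h2, h3, h4, h⟩ := (Set.Finite.mem_toFinset _).1 hq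
    have mem : ∀ z : ℕ, N < z ∧ z ≤ 2 * N → ((z : ℤ) : ℝ) ∈ Set.Icc ((N : ℝ) / 2) (2 * N) := by
      rintro z ⟨l, u⟩
      have l' : (N : ℝ) < z := by exact_mod_cast l
      have u' : (z : ℝ) ≤ 2 * N := by exact_mod_cast u
      rw [Int.cast_natCast]
      exact ⟨by linarith, u'⟩
    refine ⟨mem _ h1, mem _ h2, mem _ h3, mem _ h4, ?_⟩
    simp only [hf, Int.cast_natCast]
    exact h.le)
  rw [Finset.card_image_of_injective _ hinj, ← Set.ncard_eq_toFinset_card A hfin] at key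
  refine key.trans ?_
  have e1 : (N : ℝ) ^ (2 + 1 / ((n : ℝ) + 1)) ≤ (N : ℝ) ^ ε * (N : ℝ) ^ 2 := by
    rw [Real.rpow_add hN0, mul_comm, Real.rpow_two]
    gcongr
  have e2 : δ * (N : ℝ) ^ 4 ≤ (N : ℝ) ^ ε * ((N : ℝ) ^ 4 * δ) := by
    rw [mul_comm δ]
    exact le_mul_of_one_le_left (by positivity) (Real.one_le_rpow hN' hε.le)
  rw [mul_assoc]
  gcongr
  linarith
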